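/- (Mode-reduced energy estimate for Wψ, eq. (11).) There exists a constant C̃ > 0, depending only on M, C and s, such that for every integer ℓ ≥ s, every ε with 0 ≤ ε ≤ 1, every pair β^t, β^r satisfying the stated bounds with constant C, and every solution ψ of P_{s,ℓ}ψ = ε(β^t ∂_t ψ + β^r ∂_r ψ) (smooth up to r = 2M, with compact support in r on every compact time interval), one has for all τ > 0: E[Wψ](τ) + ∫_0^τ ∫_{2M}^∞ (1/(r D)) (∂_t Wψ)² dr dτ̃ ≤ C̃ ( E[Wψ](0) + Ī_ndeg[ψ](0,τ) + ε · I_ndeg[Wψ](0,τ) ). -/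

import Mathlib

open MeasureTheory Set
open scoped ENNReal

noncomputable section

/-- `D(r) = 1 - 2M/r`. -/
def Dc (M r : ℝ) : ℝ := 1 - 2*M/r

/-- `f(r) = (1 - 3M/r) √(1 + 6M/r)`. -/
def fc (M r : ℝ) : ℝ := (1 - 3*M/r) * Real.sqrt (1 + 6*M/r)

/-- Partial derivative in `t`. -/
def pt (ψ : ℝ → ℝ → ℝ) : ℝ → ℝ → ℝ := fun t r => deriv (fun t' => ψ t' r) t

/-- Partial derivative in `r`. -/
def pr (ψ : ℝ → ℝ → ℝ) : ℝ → ℝ → ℝ := fun t r => deriv (fun r' => ψ t r') r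

/-- `R* = (2M/r) ∂_t + D ∂_r`. -/
def Rst (M : ℝ) (ψ : ℝ → ℝ → ℝ) : ℝ → ℝ → ℝ :=
  fun t r => (2*M/r) * pt ψ t r + Dc M r * pr ψ t r

/-- `W = (r/√D)(R* + f T)`. -/
def Wc (M : ℝ) (ψ : ℝ → ℝ → ℝ) : ℝ → ℝ → ℝ :=
  fun t r => (r / Real.sqrt (Dc M r)) * (Rst M ψ t r + fc M r * pt ψ t r)

/-- The mode-reduced Regge--Wheeler operator `P_{s,ℓ}`. -/
def Pc (M : ℝ) (s ℓ : ℕ) (ψ : ℝ → ℝ → ℝ) : ℝ → ℝ → ℝ := fun t r =>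
  (1 + 2*M/r) * pt (pt ψ) t r - (4*M/r) * pt (pr ψ) t r + (2*M/r^2) * pt ψ t r
    - pr (fun t' r' => Dc M r' * pr ψ t' r') t r
    + ((ℓ : ℝ)*((ℓ : ℝ)+1)/r^2) * ψ t r + (1 - (s : ℝ)^2) * (2*M/r^3) * ψ t r

/-- Slice energy `E[ψ](τ)` (degenerate at the horizon). -/
def eE (M : ℝ) (ℓ : ℕ) (ψ : ℝ → ℝ → ℝ) (τ : ℝ) : ℝ≥0∞ :=
  ∫⁻ r in Ioi (2*M), ENNReal.ofReal
    ((pt ψ τ r)^2 + Dc M r * (pr ψ τ r)^2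
      + (ℓ : ℝ)*((ℓ : ℝ)+1)*(ψ τ r)^2/r^2 + (ψ τ r)^2/r^2)

/-- Non-degenerate slice energy `Ē[ψ](τ)`. -/
def eEbar (M : ℝ) (ℓ : ℕ) (ψ : ℝ → ℝ → ℝ) (τ : ℝ) : ℝ≥0∞ :=
  ∫⁻ r in Ioi (2*M), ENNReal.ofReal
    ((pt ψ τ r)^2 + (pr ψ τ r)^2
      + (ℓ : ℝ)*((ℓ : ℝ)+1)*(ψ τ r)^2/r^2 + (ψ τ r)^2/r^2)

/-- Spacetime energy `I_ndeg[ψ](τ₁,τ₂)` (degenerate at the horizon). -/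
def iNdeg (M : ℝ) (ℓ : ℕ) (ψ : ℝ → ℝ → ℝ) (τ₁ τ₂ : ℝ) : ℝ≥0∞ :=
  ∫⁻ τ in Ioc τ₁ τ₂, ∫⁻ r in Ioi (2*M), ENNReal.ofReal
    ((pt ψ τ r)^2/r^2 + Dc M r * (pr ψ τ r)^2/r^2
      + (ℓ : ℝ)*((ℓ : ℝ)+1)*(ψ τ r)^2/r^3 + (ψ τ r)^2/r^3)

/-- Non-degenerate spacetime energy `Ī_ndeg[ψ](τ₁,τ₂)`. -/
def iNdegBar (M : ℝ) (ℓ : ℕ) (ψ : ℝ → ℝ → ℝ) (τ₁ τ₂ : ℝ) : ℝ≥0∞ :=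
  ∫⁻ τ in Ioc τ₁ τ₂, ∫⁻ r in Ioi (2*M), ENNReal.ofReal
    ((pt ψ τ r)^2/r^2 + (pr ψ τ r)^2/r^2
      + (ℓ : ℝ)*((ℓ : ℝ)+1)*(ψ τ r)^2/r^3 + (ψ τ r)^2/r^3)

/-- Spacetime energy `Ī_deg[ψ](τ₁,τ₂)` degenerating at the photon sphere `r = 3M`. -/
def iDegBar (M : ℝ) (ℓ : ℕ) (ψ : ℝ → ℝ → ℝ) (τ₁ τ₂ : ℝ) : ℝ≥0∞ :=
  ∫⁻ τ in Ioc τ₁ τ₂, ∫⁻ r in Ioi (2*M), ENNReal.ofReal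
    ((1 - 3*M/r)^2 * ((pt ψ τ r)^2/r^2 + (pr ψ τ r)^2/r^2
        + (ℓ : ℝ)*((ℓ : ℝ)+1)*(ψ τ r)^2/r^3)
      + (Rst M ψ τ r)^2/r^2 + (ψ τ r)^2/r^3)

/-- Smoothness of a two-variable function on `ℝ × S`. -/
def SmoothOnRegion (ψ : ℝ → ℝ → ℝ) (S : Set ℝ) : Prop :=
  ContDiffOn ℝ (⊤ : ℕ∞) (Function.uncurry ψ) (univ ×ˢ S)

/-- Compact support in `r` on every compact time interval. -/
def CompactRSupport (ψ : ℝ → ℝ → ℝ) : Prop :=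
  ∀ a b : ℝ, ∃ R : ℝ, ∀ t r : ℝ, t ∈ Icc a b → R ≤ r → ψ t r = 0

/-- The pointwise bounds (5) on the perturbation `β = (β^t, β^r)`. -/
def BetaBounds (M C : ℝ) (βt βr : ℝ → ℝ → ℝ) : Prop :=
  ∀ t r : ℝ, 2*M < r →
    r^2 * |βt t r| + r^2 * |βr t r|
      + r ^ ((3:ℝ)/2) * |Wc M βt t r| + r ^ ((3:ℝ)/2) * |Wc M βr t r| ≤ C

/-- `ψ` solves the mode-reduced perturbed Regge--Wheeler equation. -/
def SolvesPerturbedRW (M : ℝ) (s ℓ : ℕ) (ε : ℝ) (βt βr ψ : ℝ → ℝ → ℝ) : Prop :=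
  ∀ t r : ℝ, 2*M < r →
    Pc M s ℓ ψ t r = ε * (βt t r * pt ψ t r + βr t r * pr ψ t r)

/-! ### Calculus on the exterior region -/

section Calculus

variable {c : ℝ} {F G : ℝ → ℝ → ℝ}

lemma isOpen_region (c : ℝ) : IsOpen ((univ : Set ℝ) ×ˢ Ioi c) := isOpen_univ.prod isOpen_Ioi

lemma region_mem_nhds {t r : ℝ} (hr : c < r) : (univ : Set ℝ) ×ˢ Ioi c ∈ nhds (t, r) :=
  (isOpen_region c).mem_nhds ⟨mem_univ _, hr⟩

lemma SmoothOnRegion.contDiffAt (hF : SmoothOnRegion F (Ioi c)) {t r : ℝ} (hr : c < r) :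
    ContDiffAt ℝ (⊤ : ℕ∞) (Function.uncurry F) (t, r) :=
  ContDiffOn.contDiffAt hF (region_mem_nhds hr)

lemma SmoothOnRegion.hasFDerivAt (hF : SmoothOnRegion F (Ioi c)) {t r : ℝ} (hr : c < r) :
    HasFDerivAt (Function.uncurry F) (fderiv ℝ (Function.uncurry F) (t, r)) (t, r) :=
  ((hF.contDiffAt hr).differentiableAt (by simp)).hasFDerivAt

lemma SmoothOnRegion.hasDerivAt_t_fderiv (hF : SmoothOnRegion F (Ioi c)) {t r : ℝ} (hr : c < r) :
    HasDerivAt (fun t' => F t' r) (fderiv ℝ (Function.uncurry F) (t, r) (1, 0)) t :=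
  HasFDerivAt.comp_hasDerivAt (f := fun t' => (t', r)) t (hF.hasFDerivAt hr)
    ((hasDerivAt_id t).prodMk (hasDerivAt_const t r))

lemma SmoothOnRegion.hasDerivAt_r_fderiv (hF : SmoothOnRegion F (Ioi c)) {t r : ℝ} (hr : c < r) :
    HasDerivAt (fun r' => F t r') (fderiv ℝ (Function.uncurry F) (t, r) (0, 1)) r :=
  HasFDerivAt.comp_hasDerivAt (f := fun r' => (t, r')) r (hF.hasFDerivAt hr)
    ((hasDerivAt_const r t).prodMk (hasDerivAt_id r))

lemma SmoothOnRegion.pt_eq (hF : SmoothOnRegion F (Ioi c)) {t r : ℝ} (hr : c < r) :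
    pt F t r = fderiv ℝ (Function.uncurry F) (t, r) (1, 0) :=
  (hF.hasDerivAt_t_fderiv hr).deriv

lemma SmoothOnRegion.pr_eq (hF : SmoothOnRegion F (Ioi c)) {t r : ℝ} (hr : c < r) :
    pr F t r = fderiv ℝ (Function.uncurry F) (t, r) (0, 1) :=
  (hF.hasDerivAt_r_fderiv hr).deriv

lemma SmoothOnRegion.hasDerivAt_t (hF : SmoothOnRegion F (Ioi c)) {t r : ℝ} (hr : c < r) :
    HasDerivAt (fun t' => F t' r) (pt F t r) t :=
  (hF.hasDerivAt_t_fderiv hr).differentiableAt.hasDerivAt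

lemma SmoothOnRegion.hasDerivAt_r (hF : SmoothOnRegion F (Ioi c)) {t r : ℝ} (hr : c < r) :
    HasDerivAt (fun r' => F t r') (pr F t r) r :=
  (hF.hasDerivAt_r_fderiv hr).differentiableAt.hasDerivAt

lemma SmoothOnRegion.congr {S : Set ℝ} (hF : SmoothOnRegion F S)
    (h : ∀ t, ∀ r ∈ S, G t r = F t r) : SmoothOnRegion G S :=
  ContDiffOn.congr hF fun x hx => h x.1 x.2 hx.2

lemma SmoothOnRegion.fderiv_apply (hF : SmoothOnRegion F (Ioi c)) (v : ℝ × ℝ) :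
    ContDiffOn ℝ (⊤ : ℕ∞) (fun x => fderiv ℝ (Function.uncurry F) x v) (univ ×ˢ Ioi c) :=
  (ContDiffOn.fderiv_of_isOpen hF (isOpen_region c) (by simp)).clm_apply contDiffOn_const

lemma SmoothOnRegion.pt (hF : SmoothOnRegion F (Ioi c)) : SmoothOnRegion (pt F) (Ioi c) :=
  ContDiffOn.congr (hF.fderiv_apply (1, 0)) fun _ hx => hF.pt_eq hx.2

lemma SmoothOnRegion.pr (hF : SmoothOnRegion F (Ioi c)) : SmoothOnRegion (pr F) (Ioi c) :=
  ContDiffOn.congr (hF.fderiv_apply (0, 1)) fun _ hx => hF.pr_eq hx.2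

lemma SmoothOnRegion.add {S : Set ℝ} (hF : SmoothOnRegion F S) (hG : SmoothOnRegion G S) :
    SmoothOnRegion (fun t r => F t r + G t r) S := ContDiffOn.add hF hG

lemma SmoothOnRegion.mul {S : Set ℝ} (hF : SmoothOnRegion F S) (hG : SmoothOnRegion G S) :
    SmoothOnRegion (fun t r => F t r * G t r) S := ContDiffOn.mul hF hG

lemma smoothOnRegion_radial {S : Set ℝ} {h : ℝ → ℝ} (hh : ContDiffOn ℝ (⊤ : ℕ∞) h S) :
    SmoothOnRegion (fun _ r => h r) S :=
  hh.comp contDiffOn_snd fun _ hx => hx.2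

lemma pt_congr (h : ∀ t r, c < r → F t r = G t r) {t r : ℝ} (hr : c < r) :
    pt F t r = pt G t r := by
  unfold pt
  congr 1
  ext t'
  exact h t' r hr

lemma pr_congr (h : ∀ t r, c < r → F t r = G t r) {t r : ℝ} (hr : c < r) :
    pr F t r = pr G t r := by
  apply Filter.EventuallyEq.deriv_eq
  filter_upwards [Ioi_mem_nhds hr] with r' hr'
  exact h t r' hr'

lemma SmoothOnRegion.pt_pr_comm (hF : SmoothOnRegion F (Ioi c)) {t r : ℝ} (hr : c < r) :
    _root_.pt (_root_.pr F) t r = _root_.pr (_root_.pt F) t r := by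
  have hd : DifferentiableAt ℝ (fderiv ℝ (Function.uncurry F)) (t, r) :=
    (((hF.contDiffAt hr).fderiv_right (m := 1) (by
      exact WithTop.coe_le_coe.2 (le_top : (1 + 1 : ℕ∞) ≤ ⊤))).differentiableAt (by simp))
  have hsymm : IsSymmSndFDerivAt ℝ (Function.uncurry F) (t, r) :=
    (hF.contDiffAt hr).isSymmSndFDerivAt (by
      simp only [minSmoothness_of_isRCLikeNormedField]; exact WithTop.coe_le_coe.2 (le_top : (2 : ℕ∞) ≤ ⊤))
  have key : ∀ v : ℝ × ℝ, fderiv ℝ (fun x => fderiv ℝ (Function.uncurry F) x v) (t, r)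
      = (fderiv ℝ (fderiv ℝ (Function.uncurry F)) (t, r)).flip v := fun v => by
    rw [fderiv_clm_apply hd (differentiableAt_const v)]
    simp
  rw [hF.pr.pt_eq hr, hF.pt.pr_eq hr]
  have e1 : Function.uncurry (_root_.pr F) =ᶠ[nhds (t, r)]
      fun x => fderiv ℝ (Function.uncurry F) x (0, 1) := by
    filter_upwards [region_mem_nhds hr] with x hx using hF.pr_eq hx.2
  have e2 : Function.uncurry (_root_.pt F) =ᶠ[nhds (t, r)]
      fun x => fderiv ℝ (Function.uncurry F) x (1, 0) := by
    filter_upwards [region_mem_nhds hr] with x hx using hF.pt_eq hx.2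
  rw [e1.fderiv_eq, e2.fderiv_eq, key, key]
  exact hsymm _ _

/-- `F` agrees for `r > c` with a function that is smooth up to and including `r = c`. -/
def SmoothUpTo (c : ℝ) (F : ℝ → ℝ → ℝ) : Prop :=
  ∃ G, SmoothOnRegion G (Ici c) ∧ ∀ t r, c < r → F t r = G t r

lemma SmoothOnRegion.smoothUpTo (hF : SmoothOnRegion F (Ici c)) : SmoothUpTo c F :=
  ⟨F, hF, fun _ _ _ => rfl⟩

lemma SmoothUpTo.smooth (hF : SmoothUpTo c F) : SmoothOnRegion F (Ioi c) := by
  obtain ⟨G, hG, h⟩ := hF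
  exact SmoothOnRegion.congr (ContDiffOn.mono hG (prod_mono_right Ioi_subset_Ici_self)) h

lemma SmoothUpTo.add (hF : SmoothUpTo c F) (hG : SmoothUpTo c G) :
    SmoothUpTo c (fun t r => F t r + G t r) := by
  obtain ⟨F', hF', hF⟩ := hF
  obtain ⟨G', hG', hG⟩ := hG
  exact ⟨_, hF'.add hG', fun t r hr => by simp only [hF t r hr, hG t r hr]⟩

lemma SmoothUpTo.mul (hF : SmoothUpTo c F) (hG : SmoothUpTo c G) :
    SmoothUpTo c (fun t r => F t r * G t r) := by
  obtain ⟨F', hF', hF⟩ := hF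
  obtain ⟨G', hG', hG⟩ := hG
  exact ⟨_, hF'.mul hG', fun t r hr => by simp only [hF t r hr, hG t r hr]⟩

lemma fderivWithin_region_apply (hG : SmoothOnRegion G (Ici c)) (v : ℝ × ℝ) :
    SmoothOnRegion (fun t r => fderivWithin ℝ (Function.uncurry G) (univ ×ˢ Ici c) (t, r) v)
      (Ici c) :=
  (ContDiffOn.fderivWithin hG (uniqueDiffOn_univ.prod (uniqueDiffOn_Ici c)) (by simp)).clm_apply
    contDiffOn_const

lemma fderivWithin_region_eq {t r : ℝ} (hr : c < r) :
    fderivWithin ℝ (Function.uncurry G) (univ ×ˢ Ici c) (t, r)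
      = fderiv ℝ (Function.uncurry G) (t, r) :=
  fderivWithin_of_mem_nhds
    (Filter.mem_of_superset (region_mem_nhds hr) (prod_mono_right Ioi_subset_Ici_self))

lemma SmoothUpTo.pt (hF : SmoothUpTo c F) : SmoothUpTo c (pt F) := by
  obtain ⟨G, hG, h⟩ := hF
  refine ⟨_, fderivWithin_region_apply hG (1, 0), fun t r hr => ?_⟩
  rw [pt_congr h hr, hG.smoothUpTo.smooth.pt_eq hr, fderivWithin_region_eq hr]

lemma SmoothUpTo.pr (hF : SmoothUpTo c F) : SmoothUpTo c (pr F) := by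
  obtain ⟨G, hG, h⟩ := hF
  refine ⟨_, fderivWithin_region_apply hG (0, 1), fun t r hr => ?_⟩
  rw [pr_congr h hr, hG.smoothUpTo.smooth.pr_eq hr, fderivWithin_region_eq hr]

lemma SmoothUpTo.bounded (hF : SmoothUpTo c F) (a b R : ℝ) :
    ∃ K, ∀ t r, t ∈ Icc a b → c < r → r ≤ R → |F t r| ≤ K := by
  obtain ⟨G, hG, h⟩ := hF
  obtain ⟨K, hK⟩ := (isCompact_Icc.prod isCompact_Icc : IsCompact (Icc a b ×ˢ Icc c R)).exists_bound_of_continuousOn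
    ((ContDiffOn.continuousOn hG).mono (prod_mono (subset_univ _) Icc_subset_Ici_self))
  exact ⟨K, fun t r ht hr hR => by simpa [h t r hr] using hK (t, r) ⟨ht, hr.le, hR⟩⟩

/-- A function vanishing on `(a,b) × (R,∞)`. -/
def VanishesOn (a b R : ℝ) (F : ℝ → ℝ → ℝ) : Prop := ∀ t r, a < t → t < b → R < r → F t r = 0

lemma VanishesOn.pt {a b R : ℝ} (h : VanishesOn a b R F) : VanishesOn a b R (pt F) := by
  intro t r ha hb hr
  have : (fun t' => F t' r) =ᶠ[nhds t] fun _ => 0 := by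
    filter_upwards [Ioo_mem_nhds ha hb] with t' ht' using h t' r ht'.1 ht'.2 hr
  exact this.deriv_eq.trans (deriv_const _ _)

lemma VanishesOn.pr {a b R : ℝ} (h : VanishesOn a b R F) : VanishesOn a b R (pr F) := by
  intro t r ha hb hr
  have : (fun r' => F t r') =ᶠ[nhds r] fun _ => 0 := by
    filter_upwards [Ioi_mem_nhds hr] with r' hr' using h t r' ha hb hr'
  exact this.deriv_eq.trans (deriv_const _ _)

end Calculus

/-! ### The radial coefficients of `W` -/

section Radial

/-- `S(r) = √(1 + 6M/r)`. -/
def sW (M r : ℝ) : ℝ := Real.sqrt (1 + 6*M/r)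

/-- `d(r) = √D(r)`. -/
def dW (M r : ℝ) : ℝ := Real.sqrt (Dc M r)

/-- The regular radial coefficient `(f + 2M/r)/D`, so that `Wψ = k (∂_r ψ + g ∂_t ψ)`. -/
def gW (M r : ℝ) : ℝ := (3*sW M r^2 + 4*sW M r - 1) / (2*(sW M r + 2))

/-- The first derivative of `gW`. -/
def gW' (M r : ℝ) : ℝ :=
  -(3*M/r^2 * (3*(sW M r + 1)*(sW M r + 3) / (2*sW M r*(sW M r + 2)^2)))

/-- The second derivative of `gW`. -/
def gW'' (M r : ℝ) : ℝ :=
  6*M/r^3 * (3*(sW M r + 1)*(sW M r + 3) / (2*sW M r*(sW M r + 2)^2))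
    + 9*M^2/r^4/sW M r * (3/2) * (((2*sW M r + 4)*sW M r*(sW M r + 2)
      - (sW M r + 1)*(sW M r + 3)*(3*sW M r + 2)) / (sW M r^2*(sW M r + 2)^3))

/-- The weight `k = r √D`. -/
def kW (M r : ℝ) : ℝ := r * dW M r

/-- The first derivative of `kW`. -/
def kW' (M r : ℝ) : ℝ := dW M r + M/(r*dW M r)

/-- The second derivative of `kW`. -/
def kW'' (M r : ℝ) : ℝ := -(M^2/(r^3*dW M r^3))

variable {M r : ℝ}

lemma Dc_pos (hM : 0 < M) (hr : 2*M < r) : 0 < Dc M r := by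
  have : 0 < r := by linarith
  unfold Dc
  rw [sub_pos, div_lt_one this]
  exact hr

lemma Dc_le_one (hM : 0 < M) (hr : 2*M < r) : Dc M r ≤ 1 := by
  have : 0 < r := by linarith
  have : 0 < 2*M/r := by positivity
  unfold Dc
  linarith

lemma dW_pos (hM : 0 < M) (hr : 2*M < r) : 0 < dW M r := Real.sqrt_pos.2 (Dc_pos hM hr)

lemma dW_sq (hM : 0 < M) (hr : 2*M < r) : dW M r^2 = Dc M r := Real.sq_sqrt (Dc_pos hM hr).le

lemma sW_sq (hM : 0 < M) (hr : 0 < r) : sW M r^2 = 1 + 6*M/r := Real.sq_sqrt (by positivity)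

lemma one_le_sW (hM : 0 < M) (hr : 0 < r) : 1 ≤ sW M r := by
  rw [sW, Real.one_le_sqrt]
  have : 0 < 6*M/r := by positivity
  linarith

lemma sW_le_two (hM : 0 < M) (hr : 2*M < r) : sW M r ≤ 2 := by
  have h0 : 0 < r := by linarith
  rw [sW, Real.sqrt_le_left (by norm_num)]
  have : 6*M/r ≤ 3 := by rw [div_le_iff₀ h0]; linarith
  linarith

lemma sW_pos (hM : 0 < M) (hr : 0 < r) : 0 < sW M r := one_pos.trans_le (one_le_sW hM hr)

lemma hasDerivAt_const_div (A : ℝ) (hr : r ≠ 0) : HasDerivAt (fun x => A/x) (-(A/r^2)) r := by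
  refine ((hasDerivAt_const r A).div (hasDerivAt_id r) hr).congr_deriv ?_
  simp [neg_div]

lemma hasDerivAt_const_div_sq (A : ℝ) (hr : r ≠ 0) :
    HasDerivAt (fun x => A/x^2) (-(2*A/r^3)) r := by
  refine ((hasDerivAt_const r A).div (hasDerivAt_pow 2 r) (pow_ne_zero 2 hr)).congr_deriv ?_
  field_simp
  norm_num
  ring

lemma hasDerivAt_const_div_cube (A : ℝ) (hr : r ≠ 0) :
    HasDerivAt (fun x => A/x^3) (-(3*A/r^4)) r := by
  refine ((hasDerivAt_const r A).div (hasDerivAt_pow 3 r) (pow_ne_zero 3 hr)).congr_deriv ?_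
  field_simp
  norm_num
  ring

lemma hasDerivAt_Dc (hr : r ≠ 0) : HasDerivAt (Dc M) (2*M/r^2) r := by
  exact ((hasDerivAt_const_div (2*M) hr).const_sub 1).congr_deriv (neg_neg _)

lemma hasDerivAt_sW (hM : 0 < M) (hr : 0 < r) :
    HasDerivAt (sW M) (-(3*M/(r^2*sW M r))) r := by
  have h := ((hasDerivAt_const_div (6*M) hr.ne').const_add 1).sqrt
    (by positivity : (1 + 6*M/r) ≠ 0)
  refine h.congr_deriv ?_
  change _ / (2*sW M r) = _
  have := (sW_pos hM hr).ne'
  field_simp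
  ring

lemma hasDerivAt_gW (hM : 0 < M) (hr : 0 < r) : HasDerivAt (gW M) (gW' M r) r := by
  have hS := hasDerivAt_sW hM hr
  have h0 := sW_pos hM hr
  refine HasDerivAt.congr_deriv ((((hS.pow 2).const_mul 3).add (hS.const_mul 4)).sub_const 1
    |>.div ((hS.add_const 2).const_mul 2) (by positivity)) ?_
  simp only [gW', Pi.add_apply, Pi.pow_apply]
  field_simp
  ring

lemma hasDerivAt_gW' (hM : 0 < M) (hr : 0 < r) : HasDerivAt (gW' M) (gW'' M r) r := by
  have hS := hasDerivAt_sW hM hr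
  have h0 := sW_pos hM hr
  refine HasDerivAt.congr_deriv ((hasDerivAt_const_div_sq (3*M) hr.ne').mul
    ((((hS.add_const 1).const_mul 3).mul (hS.add_const 3)).div
      ((hS.const_mul 2).mul ((hS.add_const 2).pow 2)) (by
        simp only [Pi.mul_apply, Pi.pow_apply]; positivity))).neg ?_
  simp only [gW'', Pi.mul_apply, Pi.pow_apply, Pi.div_apply]
  field_simp
  ring

lemma hasDerivAt_dW (hM : 0 < M) (hr : 2*M < r) : HasDerivAt (dW M) (M/(r^2*dW M r)) r := by
  have hr0 : 0 < r := by linarith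
  refine ((hasDerivAt_Dc hr0.ne').sqrt (Dc_pos hM hr).ne').congr_deriv ?_
  change _ / (2*dW M r) = _
  have := (dW_pos hM hr).ne'
  field_simp

lemma hasDerivAt_kW (hM : 0 < M) (hr : 2*M < r) : HasDerivAt (kW M) (kW' M r) r := by
  have hr0 : 0 < r := by linarith
  refine ((hasDerivAt_id r).mul (hasDerivAt_dW hM hr)).congr_deriv ?_
  have := (dW_pos hM hr).ne'
  simp only [kW', id]
  field_simp

lemma hasDerivAt_kW' (hM : 0 < M) (hr : 2*M < r) : HasDerivAt (kW' M) (kW'' M r) r := by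
  have hr0 : 0 < r := by linarith
  have hd := hasDerivAt_dW hM hr
  have h0 := dW_pos hM hr
  refine HasDerivAt.congr_deriv (hd.add (((hasDerivAt_const r M)).div ((hasDerivAt_id r).mul hd)
    (by positivity : r * dW M r ≠ 0))) ?_
  simp only [kW'', id]
  field_simp
  ring

lemma contDiffOn_gW (hM : 0 < M) : ContDiffOn ℝ (⊤ : ℕ∞) (gW M) (Ioi 0) := by
  have hs : ContDiffOn ℝ (⊤ : ℕ∞) (sW M) (Ioi 0) := by
    refine ContDiffOn.sqrt (contDiffOn_const.add (contDiffOn_const.div contDiffOn_id ?_)) ?_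
    · intro x hx; exact (show (0:ℝ) < x from hx).ne'
    · intro x hx
      have : (0:ℝ) < x := hx
      positivity
  refine ContDiffOn.div ?_ (contDiffOn_const.mul (hs.add contDiffOn_const)) ?_
  · exact ((contDiffOn_const.mul (hs.pow 2)).add (contDiffOn_const.mul hs)).sub contDiffOn_const
  · intro x hx
    have := sW_pos hM hx
    positivity

lemma contDiffOn_Dc : ContDiffOn ℝ (⊤ : ℕ∞) (Dc M) (Ioi 0) :=
  contDiffOn_const.sub (contDiffOn_const.div contDiffOn_id
    fun x hx => (show (0:ℝ) < x from hx).ne')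

lemma contDiffOn_kW (hM : 0 < M) : ContDiffOn ℝ (⊤ : ℕ∞) (kW M) (Ioi (2*M)) := by
  refine contDiffOn_id.mul (ContDiffOn.sqrt (contDiffOn_Dc.mono ?_) ?_)
  · exact fun x hx => lt_trans (by linarith) (show 2*M < x from hx)
  · exact fun x hx => (Dc_pos hM hx).ne'

end Radial

/-! ### The equation satisfied by `Wψ` -/

section Commutation

lemma commutation_identity (M r S d lam sg p a b att atr at' ar br brr arr E Et Er k1 k2d g g1 g2 : ℝ)
   (hr : r ≠ 0) (hS : 0 < S) (hd : d ≠ 0) (hM : M = r*(S^2-1)/6) (hD : d^2 = (4-S^2)/3)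
   (hg : g = (3*S^2+4*S-1)/(2*(S+2)))
   (hg1 : g1 = -(3*M/r^2*(3*(S+1)*(S+3)/(2*S*(S+2)^2))))
   (hg2 : g2 = 6*M/r^3*(3*(S+1)*(S+3)/(2*S*(S+2)^2)) + 9*M^2/r^4/S*(3/2)*(((2*S+4)*S*(S+2) - (S+1)*(S+3)*(3*S+2))/(S^2*(S+2)^3)))
   (hk1 : k1 = d + M/(r*d)) (hk2 : k2d = -(M^2/(r^3*d)))
   (hP : (1+2*M/r)*at' - (4*M/r)*ar + (2*M/r^2)*a - (2*M/r^2*b + d^2*br) + lam/r^2*p + sg*(2*M/r^3)*p = E)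
   (hPt : (1+2*M/r)*att - (4*M/r)*atr + (2*M/r^2)*at' - (2*M/r^2*ar + d^2*arr) + lam/r^2*a + sg*(2*M/r^3)*a = Et)
   (hPr : (1+2*M/r)*atr - (2*M/r^2)*at' - (4*M/r)*arr + (4*M/r^2)*ar + (2*M/r^2)*ar - (4*M/r^3)*a
      - (-(4*M/r^3)*b + 2*M/r^2*br + 2*M/r^2*br + d^2*brr)
      + lam/r^2*b - 2*lam/r^3*p + sg*(2*M/r^3)*b - sg*(6*M/r^4)*p= Er) :
   (1+2*M/r)*(r*d*(atr + g*att)) - (4*M/r)*(k1*(ar+g*at') + r*d*(arr+g*atr+g1*at'))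
    + (2*M/r^2)*(r*d*(ar+g*at'))
    - (2*M/r^2*(k1*(b+g*a) + r*d*(br+g*ar+g1*a))
       + (k2d*(b+g*a) + d^2*(2*k1*(br+g*ar+g1*a) + r*d*(brr + g*arr+2*g1*ar+g2*a))))
    + lam/r^2*(r*d*(b+g*a)) + sg*(2*M/r^3)*(r*d*(b+g*a))
   = -(2*(r*d*(ar+g*at'))/(r*d^2*S))
     - 1/d*(M/r^2)*((2-3*(M/r))*b + (S^6+2*S^5-2*S^4-4*S^3-3*S^2+6*S+12)/(2*S^3*(2+S))*a)
     + sg*2*M*d/r^3*p + 2*d*E + r*d*(Er+g*Et) := by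
  rw [← hP, ← hPt, ← hPr]
  have hS2 : S + 2 ≠ 0 := by positivity
  have hS2' : 2 + S ≠ 0 := by positivity
  have hS0 : S ≠ 0 := hS.ne'
  have e1 : (4-S^2) ≠ 0 := by
    intro h; apply hd; rw [h] at hD; simpa using hD
  obtain ⟨v, hv⟩ : ∃ v, v = 1/d := ⟨_, rfl⟩
  have hdv : d = v * ((4-S^2)/3) := by rw [← hD, hv]; field_simp
  have hk1' : k1 = v * ((4-S^2)/3 + M/r) := by rw [hk1, ← hD, hv]; field_simp
  have hk2' : k2d = v * (-(M^2/r^3)) := by rw [hk2, hv]; field_simp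
  rw [← hv, hD, hk1', hk2', hdv]
  clear hv hk1 hk2 hk1' hk2' hD hdv hd hP hPt hPr
  subst hg hg1 hg2 hM
  field_simp
  ring

variable {M : ℝ} {s ℓ : ℕ} {ψ F E : ℝ → ℝ → ℝ}

lemma f_add_eq {r : ℝ} (hM : 0 < M) (hr : 2*M < r) :
    2*M/r + fc M r = dW M r^2 * gW M r := by
  have h0 : 0 < r := by linarith
  have hS := sW_sq hM h0
  have hSp := sW_pos hM h0
  have hM' : M/r = (sW M r^2 - 1)/6 := by rw [hS]; ring
  have e : fc M r = (1 - 3*(M/r)) * sW M r := by rw [fc, sW]; ring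
  have e2 : 2*M/r = 2*(M/r) := by ring
  rw [e, dW_sq hM hr, Dc, e2, hM', gW]
  field_simp
  ring

lemma Wc_eq (F : ℝ → ℝ → ℝ) (hM : 0 < M) (t : ℝ) {r : ℝ} (hr : 2*M < r) :
    Wc M F t r = kW M r * (pr F t r + gW M r * pt F t r) := by
  have hd := (dW_pos hM hr).ne'
  have e : Rst M F t r + fc M r * pt F t r
      = dW M r^2 * (pr F t r + gW M r * pt F t r) := by
    rw [Rst]
    linear_combination (pt F t r) * f_add_eq hM hr - pr F t r * dW_sq hM hr
  rw [Wc, e, kW]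
  change r / dW M r * _ = _
  field_simp

lemma Wc_smooth (hM : 0 < M) (hF : SmoothOnRegion F (Ioi (2*M))) :
    SmoothOnRegion (Wc M F) (Ioi (2*M)) := by
  have hg : SmoothOnRegion (fun _ r => gW M r) (Ioi (2*M)) :=
    smoothOnRegion_radial ((contDiffOn_gW hM).mono (Ioi_subset_Ioi (by linarith)))
  exact ((smoothOnRegion_radial (contDiffOn_kW hM)).mul (hF.pr.add (hg.mul hF.pt))).congr
    fun t r hr => Wc_eq F hM t hr

lemma pt_Wc (hM : 0 < M) (hF : SmoothOnRegion F (Ioi (2*M))) (t : ℝ) {r : ℝ} (hr : 2*M < r) :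
    pt (Wc M F) t r = kW M r * (pr (pt F) t r + gW M r * pt (pt F) t r) := by
  rw [pt_congr (fun t r hr => Wc_eq F hM t hr) hr, ← hF.pt_pr_comm hr]
  exact (((hF.pr.hasDerivAt_t hr).add ((hF.pt.hasDerivAt_t hr).const_mul _)).const_mul _).deriv

lemma hasDerivAt_regular (hM : 0 < M) (hF : SmoothOnRegion F (Ioi (2*M))) (t : ℝ) {r : ℝ}
    (hr : 2*M < r) :
    HasDerivAt (fun r' => pr F t r' + gW M r' * pt F t r')
      (pr (pr F) t r + (gW' M r * pt F t r + gW M r * pr (pt F) t r)) r :=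
  (hF.pr.hasDerivAt_r hr).add
    ((hasDerivAt_gW hM (by linarith)).mul (hF.pt.hasDerivAt_r hr))

lemma pr_Wc (hM : 0 < M) (hF : SmoothOnRegion F (Ioi (2*M))) (t : ℝ) {r : ℝ} (hr : 2*M < r) :
    pr (Wc M F) t r = kW' M r * (pr F t r + gW M r * pt F t r)
      + kW M r * (pr (pr F) t r + (gW' M r * pt F t r + gW M r * pr (pt F) t r)) := by
  rw [pr_congr (fun t r hr => Wc_eq F hM t hr) hr]
  exact ((hasDerivAt_kW hM hr).mul (hasDerivAt_regular hM hF t hr)).deriv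

lemma pt_Wc_comm (hM : 0 < M) (hF : SmoothOnRegion F (Ioi (2*M))) (t : ℝ) {r : ℝ} (hr : 2*M < r) :
    pt (Wc M F) t r = Wc M (pt F) t r := by
  rw [pt_Wc hM hF t hr, Wc_eq _ hM t hr]

lemma pr_pr_Wc (hM : 0 < M) (hF : SmoothOnRegion F (Ioi (2*M))) (t : ℝ) {r : ℝ} (hr : 2*M < r) :
    pr (pr (Wc M F)) t r = kW'' M r * (pr F t r + gW M r * pt F t r)
      + 2 * kW' M r * (pr (pr F) t r + (gW' M r * pt F t r + gW M r * pr (pt F) t r))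
      + kW M r * (pr (pr (pr F)) t r + (gW'' M r * pt F t r + 2 * gW' M r * pr (pt F) t r
          + gW M r * pr (pr (pt F)) t r)) := by
  rw [pr_congr (fun t r hr => pr_Wc hM hF t hr) hr]
  have h0 : 0 < r := by linarith
  refine (((hasDerivAt_kW' hM hr).mul (hasDerivAt_regular hM hF t hr)).add
    ((hasDerivAt_kW hM hr).mul ((hF.pr.pr.hasDerivAt_r hr).add
      (((hasDerivAt_gW' hM h0).mul (hF.pt.hasDerivAt_r hr)).add
        ((hasDerivAt_gW hM h0).mul (hF.pt.pr.hasDerivAt_r hr)))))).deriv.trans ?_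
  simp only [Pi.add_apply, Pi.mul_apply]
  ring

lemma Pc_eq (hM : 0 < M) (hF : SmoothOnRegion F (Ioi (2*M))) (t : ℝ) {r : ℝ} (hr : 2*M < r) :
    Pc M s ℓ F t r = (1 + 2*M/r) * pt (pt F) t r - (4*M/r) * pr (pt F) t r
      + (2*M/r^2) * pt F t r - (2*M/r^2 * pr F t r + Dc M r * pr (pr F) t r)
      + ((ℓ : ℝ)*((ℓ : ℝ)+1)/r^2) * F t r + (1 - (s : ℝ)^2) * (2*M/r^3) * F t r := by
  have h0 : r ≠ 0 := by linarith
  have e : pr (fun t' r' => Dc M r' * pr F t' r') t r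
      = 2*M/r^2 * pr F t r + Dc M r * pr (pr F) t r :=
    ((hasDerivAt_Dc h0).mul (hF.pr.hasDerivAt_r hr)).deriv
  rw [Pc, e, hF.pt_pr_comm hr]

lemma pt_Pc (hM : 0 < M) (hF : SmoothOnRegion F (Ioi (2*M))) (t : ℝ) {r : ℝ} (hr : 2*M < r) :
    pt (Pc M s ℓ F) t r = (1 + 2*M/r) * pt (pt (pt F)) t r - (4*M/r) * pr (pt (pt F)) t r
      + (2*M/r^2) * pt (pt F) t r - (2*M/r^2 * pr (pt F) t r + Dc M r * pr (pr (pt F)) t r)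
      + ((ℓ : ℝ)*((ℓ : ℝ)+1)/r^2) * pt F t r + (1 - (s : ℝ)^2) * (2*M/r^3) * pt F t r := by
  rw [pt_congr (fun t r hr => Pc_eq hM hF t hr) hr]
  have e1 := hF.pt.pt_pr_comm (t := t) hr
  have e2 := hF.pt_pr_comm (t := t) hr
  have e3 : pt (pr (pr F)) t r = pr (pr (pt F)) t r := by
    rw [hF.pr.pt_pr_comm hr, pr_congr (fun t r hr => hF.pt_pr_comm (t := t) hr) hr]
  rw [← e1, ← e2, ← e3]
  exact ((((((hF.pt.pt.hasDerivAt_t hr).const_mul _).sub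
    ((hF.pt.pr.hasDerivAt_t hr).const_mul _)).add ((hF.pt.hasDerivAt_t hr).const_mul _)).sub
    (((hF.pr.hasDerivAt_t hr).const_mul _).add ((hF.pr.pr.hasDerivAt_t hr).const_mul _))).add
    ((hF.hasDerivAt_t hr).const_mul _)).add ((hF.hasDerivAt_t hr).const_mul _) |>.deriv

lemma pr_Pc (hM : 0 < M) (hF : SmoothOnRegion F (Ioi (2*M))) (t : ℝ) {r : ℝ} (hr : 2*M < r) :
    pr (Pc M s ℓ F) t r = (1 + 2*M/r) * pr (pt (pt F)) t r - (2*M/r^2) * pt (pt F) t r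
      - (4*M/r) * pr (pr (pt F)) t r + (4*M/r^2) * pr (pt F) t r
      + (2*M/r^2) * pr (pt F) t r - (4*M/r^3) * pt F t r
      - (-(4*M/r^3) * pr F t r + 2*M/r^2 * pr (pr F) t r + 2*M/r^2 * pr (pr F) t r
        + Dc M r * pr (pr (pr F)) t r)
      + (ℓ : ℝ)*((ℓ : ℝ)+1)/r^2 * pr F t r - 2*((ℓ : ℝ)*((ℓ : ℝ)+1))/r^3 * F t r
      + (1 - (s : ℝ)^2) * (2*M/r^3) * pr F t r - (1 - (s : ℝ)^2) * (6*M/r^4) * F t r := by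
  rw [pr_congr (fun t r hr => Pc_eq hM hF t hr) hr]
  have h0 : r ≠ 0 := by linarith
  refine (((((((((hasDerivAt_const_div (2*M) h0).const_add 1).mul (hF.pt.pt.hasDerivAt_r hr)).sub
    ((hasDerivAt_const_div (4*M) h0).mul (hF.pt.pr.hasDerivAt_r hr))).add
    ((hasDerivAt_const_div_sq (2*M) h0).mul (hF.pt.hasDerivAt_r hr))).sub
    (((hasDerivAt_const_div_sq (2*M) h0).mul (hF.pr.hasDerivAt_r hr)).add
      ((hasDerivAt_Dc h0).mul (hF.pr.pr.hasDerivAt_r hr)))).add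
    ((hasDerivAt_const_div_sq ((ℓ : ℝ)*((ℓ : ℝ)+1)) h0).mul (hF.hasDerivAt_r hr))).add
    (((hasDerivAt_const_div_cube (2*M) h0).const_mul (1 - (s : ℝ)^2)).mul
      (hF.hasDerivAt_r hr))).deriv).trans ?_
  ring

/-- The bounded coefficient of `∂_t ψ` in the commuted equation. -/
def hW (M r : ℝ) : ℝ :=
  (sW M r^6 + 2*sW M r^5 - 2*sW M r^4 - 4*sW M r^3 - 3*sW M r^2 + 6*sW M r + 12)
    / (2*sW M r^3*(2 + sW M r))

lemma Pc_Wc (hM : 0 < M) (hψ : SmoothOnRegion ψ (Ioi (2*M)))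
    (hE : ∀ t r, 2*M < r → Pc M s ℓ ψ t r = E t r) (t : ℝ) {r : ℝ} (hr : 2*M < r) :
    Pc M s ℓ (Wc M ψ) t r = -(2 * pt (Wc M ψ) t r / (r * Dc M r * sW M r))
      - 1/dW M r * (M/r^2) * ((2 - 3*(M/r)) * pr ψ t r + hW M r * pt ψ t r)
      + (1 - (s : ℝ)^2) * 2 * M * dW M r / r^3 * ψ t r + 2 * dW M r * E t r
      + Wc M E t r := by
  have h0 : 0 < r := by linarith
  have hW := Wc_smooth hM hψ
  have hP := (Pc_eq (s := s) (ℓ := ℓ) hM hψ t hr).symm.trans (hE t r hr)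
  have hPt := (pt_Pc (s := s) (ℓ := ℓ) hM hψ t hr).symm.trans (pt_congr hE hr)
  have hPr := (pr_Pc (s := s) (ℓ := ℓ) hM hψ t hr).symm.trans (pr_congr hE hr)
  have htt : pt (pt (Wc M ψ)) t r
      = kW M r * (pr (pt (pt ψ)) t r + gW M r * pt (pt (pt ψ)) t r) := by
    rw [pt_congr (fun t r hr => pt_Wc_comm hM hψ t hr) hr, pt_Wc hM hψ.pt t hr]
  have htr : pr (pt (Wc M ψ)) t r = kW' M r * (pr (pt ψ) t r + gW M r * pt (pt ψ) t r)
      + kW M r * (pr (pr (pt ψ)) t r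
        + (gW' M r * pt (pt ψ) t r + gW M r * pr (pt (pt ψ)) t r)) := by
    rw [pr_congr (fun t r hr => pt_Wc_comm hM hψ t hr) hr, pr_Wc hM hψ.pt t hr]
  have hMr : M = r*(sW M r^2 - 1)/6 := by rw [sW_sq hM h0]; field_simp; ring
  have hD : dW M r^2 = (4 - sW M r^2)/3 := by
    rw [dW_sq hM hr, sW_sq hM h0, Dc]; field_simp; ring
  have key := commutation_identity M r (sW M r) (dW M r) ((ℓ : ℝ)*((ℓ : ℝ)+1)) (1 - (s : ℝ)^2)
    (ψ t r) (pt ψ t r) (pr ψ t r) (pt (pt (pt ψ)) t r) (pr (pt (pt ψ)) t r) (pt (pt ψ) t r)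
    (pr (pt ψ) t r) (pr (pr ψ) t r) (pr (pr (pr ψ)) t r) (pr (pr (pt ψ)) t r)
    (E t r) (pt E t r) (pr E t r) (kW' M r) (dW M r^2 * kW'' M r) (gW M r) (gW' M r) (gW'' M r)
    h0.ne' (sW_pos hM h0) (dW_pos hM hr).ne' hMr hD rfl rfl rfl rfl
    (by have := (dW_pos hM hr).ne'; rw [kW'']; field_simp)
    (by rw [dW_sq hM hr]; exact hP) (by rw [dW_sq hM hr]; exact hPt)
    (by rw [dW_sq hM hr]; exact hPr)
  rw [Pc_eq hM hW t hr, htt, htr, pr_pr_Wc hM hψ t hr, pr_Wc hM hψ t hr, pt_Wc hM hψ t hr,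
    Wc_eq ψ hM t hr, Wc_eq E hM t hr, ← dW_sq hM hr]
  simp only [kW]
  rw [← _root_.hW] at key
  linear_combination key

end Commutation

/-! ### The pointwise energy inequality -/

section Pointwise

variable {M C : ℝ} {s ℓ : ℕ} {ψ F βt βr : ℝ → ℝ → ℝ}

/-- The energy density of the `∂_t`-multiplier. -/
def eT (M : ℝ) (s ℓ : ℕ) (F : ℝ → ℝ → ℝ) : ℝ → ℝ → ℝ := fun t r =>
  1/2 * ((1 + 2*M/r) * pt F t r^2 + Dc M r * pr F t r^2
    + ((ℓ : ℝ)*((ℓ : ℝ)+1)/r^2 + (1 - (s : ℝ)^2) * (2*M/r^3)) * F t r^2)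

/-- The radial flux of the `∂_t`-multiplier. -/
def qT (M : ℝ) (F : ℝ → ℝ → ℝ) : ℝ → ℝ → ℝ := fun t r =>
  -(2*M/r * pt F t r^2 + Dc M r * pr F t r * pt F t r)

/-- The integrand of `eE`. -/
def densE (M : ℝ) (ℓ : ℕ) (F : ℝ → ℝ → ℝ) : ℝ → ℝ → ℝ := fun t r =>
  (pt F t r)^2 + Dc M r * (pr F t r)^2 + (ℓ : ℝ)*((ℓ : ℝ)+1)*(F t r)^2/r^2 + (F t r)^2/r^2

/-- The integrand of `iNdeg`. -/
def densI (M : ℝ) (ℓ : ℕ) (F : ℝ → ℝ → ℝ) : ℝ → ℝ → ℝ := fun t r =>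
  (pt F t r)^2/r^2 + Dc M r * (pr F t r)^2/r^2
    + (ℓ : ℝ)*((ℓ : ℝ)+1)*(F t r)^2/r^3 + (F t r)^2/r^3

/-- The integrand of `iNdegBar`. -/
def densIBar (ℓ : ℕ) (F : ℝ → ℝ → ℝ) : ℝ → ℝ → ℝ := fun t r =>
  (pt F t r)^2/r^2 + (pr F t r)^2/r^2 + (ℓ : ℝ)*((ℓ : ℝ)+1)*(F t r)^2/r^3 + (F t r)^2/r^3

lemma energy_divergence (hM : 0 < M) (hF : SmoothOnRegion F (Ioi (2*M))) (t : ℝ) {r : ℝ}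
    (hr : 2*M < r) :
    pt (eT M s ℓ F) t r + pr (qT M F) t r = pt F t r * Pc M s ℓ F t r := by
  have h0 : r ≠ 0 := by linarith
  have he : HasDerivAt (fun t' => eT M s ℓ F t' r) _ t :=
    (((((hF.pt.hasDerivAt_t hr).pow 2).const_mul (1 + 2*M/r)).add
      (((hF.pr.hasDerivAt_t hr).pow 2).const_mul (Dc M r))).add
      (((hF.hasDerivAt_t hr).pow 2).const_mul
        ((ℓ : ℝ)*((ℓ : ℝ)+1)/r^2 + (1 - (s : ℝ)^2) * (2*M/r^3)))).const_mul (1/2)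
  have hq : HasDerivAt (fun r' => qT M F t r') _ r :=
    (((hasDerivAt_const_div (2*M) h0).mul ((hF.pt.hasDerivAt_r hr).pow 2)).add
      (((hasDerivAt_Dc h0).mul (hF.pr.hasDerivAt_r hr)).mul (hF.pt.hasDerivAt_r hr))).neg
  have e1 : pt (eT M s ℓ F) t r = _ := he.deriv
  have e2 : pr (qT M F) t r = _ := hq.deriv
  rw [e1, e2, Pc_eq hM hF t hr, hF.pt_pr_comm hr]
  simp only [Pi.mul_apply, Pi.pow_apply]
  ring

lemma abs_gW_le (hM : 0 < M) {r : ℝ} (hr : 2*M < r) : |gW M r| ≤ 4 := by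
  have h1 := one_le_sW hM (show 0 < r by linarith)
  have h2 := sW_le_two hM hr
  rw [gW, abs_le, le_div_iff₀ (by positivity), div_le_iff₀ (by positivity)]
  constructor <;> nlinarith

lemma abs_gW'_le (hM : 0 < M) {r : ℝ} (hr : 2*M < r) : |gW' M r| ≤ 15/r := by
  have h0 : 0 < r := by linarith
  have h1 := one_le_sW hM h0
  have h2 := sW_le_two hM hr
  have e1 : 3*M/r^2 ≤ 2/r := by
    rw [div_le_div_iff₀ (by positivity) h0]; nlinarith
  have e2 : 3*(sW M r + 1)*(sW M r + 3) / (2*sW M r*(sW M r + 2)^2) ≤ 15/2 := by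
    rw [div_le_iff₀ (by positivity)]
    nlinarith [mul_nonneg (sub_nonneg.2 h1) (sub_nonneg.2 h1), pow_pos (one_pos.trans_le h1) 3]
  rw [gW', abs_neg, abs_of_nonneg (by positivity)]
  calc _ ≤ 2/r * (15/2) := by gcongr
    _ = 15/r := by ring

lemma abs_hW_le (hM : 0 < M) {r : ℝ} (hr : 2*M < r) : |hW M r| ≤ 40 := by
  have h1 := one_le_sW hM (show 0 < r by linarith)
  have h2 := sW_le_two hM hr
  have p2 : sW M r^2 ≤ 2^2 := by gcongr
  have p3 : sW M r^3 ≤ 2^3 := by gcongr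
  have p4 : sW M r^4 ≤ 2^4 := by gcongr
  have p5 : sW M r^5 ≤ 2^5 := by gcongr
  have p6 : sW M r^6 ≤ 2^6 := by gcongr
  have q2 : 1 ≤ sW M r^2 := one_le_pow₀ h1
  have q3 : 1 ≤ sW M r^3 := one_le_pow₀ h1
  have q4 : 1 ≤ sW M r^4 := one_le_pow₀ h1
  have q5 : 1 ≤ sW M r^5 := one_le_pow₀ h1
  have q6 : 1 ≤ sW M r^6 := one_le_pow₀ h1
  have hden : 6 ≤ 2*sW M r^3*(2 + sW M r) := by nlinarith
  rw [hW, abs_le, le_div_iff₀ (by positivity), div_le_iff₀ (by positivity)]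
  constructor <;> linarith

set_option maxHeartbeats 1000000 in
/-- Weighted bound for the source terms of the commuted equation. -/
lemma source_bound {M C Y ρ r d k1 g g1 h sg ε p a b at' ar bt br wt wr E : ℝ}
    (hM : 0 < M) (hC : 0 < C) (hρ : 0 < ρ) (hrρ : r = ρ^2) (hr : 2*M < r) (hY : 1/ρ ≤ Y)
    (hd : 0 < d) (hd1 : d ≤ 1) (hk1 : 0 ≤ d*k1) (hk1' : d*k1 ≤ 2) (hg : |g| ≤ 4)
    (hg1 : |g1| ≤ 15/r) (hh : |h| ≤ 40) (hsg : |sg| ≤ 3) (hε : 0 ≤ ε) (hε1 : ε ≤ 1)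
    (hbt : |bt| ≤ C/r^2) (hbr : |br| ≤ C/r^2) (hwt : |wt| ≤ C/ρ^3) (hwr : |wr| ≤ C/ρ^3)
    (hE : E = ε * (bt*a + br*b)) :
    |d * ρ * (-(1/d * (M/r^2) * ((2 - 3*(M/r))*b + h*a)) + sg*2*M*d/r^3*p + 2*d*E
      + ε * (wt*a + wr*b + bt*at' + br*(ar - k1*(b + g*a) - r*d*g1*a)))|
    ≤ (40*M*Y + 3 + C + 40*C*Y) *
      (|a|/r + |b|/r + |p|/ρ^3 + ε*(|at'|/r) + ε*(d*|ar|/r)) := by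
  have h0 : 0 < r := by linarith
  have hY0 : 0 < Y := lt_of_lt_of_le (by positivity) hY
  have hx : M/r ≤ 1/2 := by rw [div_le_div_iff₀ h0 two_pos]; linarith
  have hx0 : 0 < M/r := by positivity
  have hρr : ρ/r^2 = 1/ρ*(1/r) := by rw [hrρ]; field_simp
  have hρr' : ρ/r^2 ≤ Y*(1/r) := by rw [hρr]; gcongr
  have hB0 : 0 ≤ ρ * (C/r^2) := by positivity
  have hB : ρ * (C/r^2) ≤ C*Y*(1/r) := by
    calc ρ * (C/r^2) = C * (ρ/r^2) := by ring
      _ ≤ C * (Y*(1/r)) := by gcongr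
      _ = _ := by ring
  have t1 : |ρ * (M/r^2) * ((2 - 3*(M/r))*b + h*a)| ≤ M*Y*(1/r)*(2*|b| + 40*|a|) := by
    rw [abs_mul, abs_of_nonneg (by positivity : 0 ≤ ρ * (M/r^2))]
    have e1 : ρ * (M/r^2) ≤ M*Y*(1/r) := by
      calc ρ * (M/r^2) = M * (ρ/r^2) := by ring
        _ ≤ M * (Y*(1/r)) := by gcongr
        _ = _ := by ring
    have e2 : |(2 - 3*(M/r))*b + h*a| ≤ 2*|b| + 40*|a| := by
      refine (abs_add_le _ _).trans ?_
      rw [abs_mul, abs_mul]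
      have : |2 - 3*(M/r)| ≤ 2 := by rw [abs_le]; constructor <;> linarith
      gcongr
    gcongr
  have t2 : |d * ρ * (sg*2*M*d/r^3*p)| ≤ 3*(|p|/ρ^3) := by
    have e : d * ρ * (sg*2*M*d/r^3*p) = (sg * (d*d) * (2*(M/r))) * (p/ρ^3) := by
      rw [hrρ]; field_simp
    rw [e, abs_mul, abs_div, abs_of_pos (by positivity : 0 < ρ^3), abs_mul, abs_mul,
      abs_of_pos (by positivity : 0 < d*d), abs_of_pos (by positivity : 0 < 2*(M/r))]
    have : |sg| * (d*d) * (2*(M/r)) ≤ 3 * (1*1) * (2*(1/2)) := by gcongr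
    calc _ ≤ 3 * (1*1) * (2*(1/2)) * (|p|/ρ^3) := by gcongr
      _ = _ := by ring
  have t3 : |d * ρ * (2*d*E)| ≤ 2*C*Y*(1/r)*(|a| + |b|) := by
    have e1 : |bt*a + br*b| ≤ C/r^2 * (|a| + |b|) := by
      refine (abs_add_le _ _).trans ?_
      rw [abs_mul, abs_mul, mul_add]
      gcongr
    rw [hE, show d * ρ * (2*d*(ε * (bt*a + br*b))) = (2*(d*d)*ε*ρ) * (bt*a + br*b) by ring,
      abs_mul, abs_of_nonneg (by positivity)]
    calc 2*(d*d)*ε*ρ * |bt*a + br*b| ≤ 2*(1*1)*1*ρ*(C/r^2 * (|a| + |b|)) := by gcongr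
      _ = 2 * (ρ * (C/r^2)) * (|a| + |b|) := by ring
      _ ≤ 2 * (C*Y*(1/r)) * (|a| + |b|) := by gcongr
      _ = _ := by ring
  have t4 : |d * ρ * (ε * (wt*a + wr*b))| ≤ C*(1/r)*(|a| + |b|) := by
    have e1 : |wt*a + wr*b| ≤ C/ρ^3 * (|a| + |b|) := by
      refine (abs_add_le _ _).trans ?_
      rw [abs_mul, abs_mul, mul_add]
      gcongr
    rw [← mul_assoc, abs_mul, abs_of_nonneg (by positivity)]
    calc d * ρ * ε * |wt*a + wr*b| ≤ 1 * ρ * 1 * (C/ρ^3 * (|a| + |b|)) := by gcongr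
      _ = _ := by rw [hrρ]; field_simp
  have t5 : |d * ρ * (ε * (bt*at'))| ≤ C*Y*(ε*(|at'|/r)) := by
    rw [show d * ρ * (ε * (bt*at')) = (d*ρ*ε)*(bt*at') by ring, abs_mul, abs_mul bt,
      abs_of_nonneg (by positivity)]
    calc d * ρ * ε * (|bt| * |at'|) ≤ 1 * ρ * ε * (C/r^2 * |at'|) := by gcongr
      _ = ρ * (C/r^2) * (ε * |at'|) := by ring
      _ ≤ C*Y*(1/r) * (ε * |at'|) := by gcongr
      _ = _ := by ring
  have t6 : |d * ρ * (ε * (br*(ar - k1*(b + g*a) - r*d*g1*a)))|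
      ≤ C*Y*(ε*(d*|ar|/r)) + C*Y*(1/r)*(2*|b| + 23*|a|) := by
    rw [show d * ρ * (ε * (br*(ar - k1*(b + g*a) - r*d*g1*a)))
      = (ρ*br) * (ε*(d*ar) - ε*((d*k1)*(b + g*a)) - ε*(d*(d*((r*g1)*a)))) by ring, abs_mul,
      abs_mul, abs_of_pos hρ]
    have e0 : ρ * |br| ≤ C*Y*(1/r) := le_trans (by gcongr) hB
    have f1 : |ε*(d*ar)| ≤ ε*(d*|ar|) := by
      rw [abs_mul, abs_mul, abs_of_nonneg hε, abs_of_pos hd]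
    have f2 : |ε*((d*k1)*(b + g*a))| ≤ 1*(2*(|b| + 4*|a|)) := by
      rw [abs_mul, abs_mul, abs_of_nonneg hε, abs_of_nonneg hk1]
      have : |b + g*a| ≤ |b| + 4*|a| := by
        refine (abs_add_le _ _).trans ?_
        rw [abs_mul]; gcongr
      gcongr
    have f3 : |ε*(d*(d*((r*g1)*a)))| ≤ 1 * (1 * (1 * (15 * |a|))) := by
      rw [abs_mul, abs_mul, abs_mul, abs_mul, abs_mul, abs_of_nonneg hε, abs_of_pos hd,
        abs_of_pos h0]
      have : r*|g1| ≤ 15 := by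
        rw [le_div_iff₀ h0] at hg1; linarith
      gcongr
    have e1 : |ε*(d*ar) - ε*((d*k1)*(b + g*a)) - ε*(d*(d*((r*g1)*a)))|
        ≤ ε*(d*|ar|) + (2*|b| + 23*|a|) := by
      refine (abs_sub _ _).trans ?_
      have := abs_sub (ε*(d*ar)) (ε*((d*k1)*(b + g*a)))
      linarith
    calc _ ≤ C*Y*(1/r) * (ε*(d*|ar|) + (2*|b| + 23*|a|)) := by gcongr
      _ = _ := by ring
  have split : d * ρ * (-(1/d * (M/r^2) * ((2 - 3*(M/r))*b + h*a)) + sg*2*M*d/r^3*p + 2*d*E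
      + ε * (wt*a + wr*b + bt*at' + br*(ar - k1*(b + g*a) - r*d*g1*a)))
      = -(ρ * (M/r^2) * ((2 - 3*(M/r))*b + h*a)) + d * ρ * (sg*2*M*d/r^3*p)
        + d * ρ * (2*d*E) + d * ρ * (ε * (wt*a + wr*b)) + d * ρ * (ε * (bt*at'))
        + d * ρ * (ε * (br*(ar - k1*(b + g*a) - r*d*g1*a))) := by
    linear_combination (-(ρ * (M/r^2) * ((2 - 3*(M/r))*b + h*a))) * mul_one_div_cancel hd.ne'
  rw [split]
  have tri : ∀ u v w x y z : ℝ, |(-u) + v + w + x + y + z| ≤ |u| + |v| + |w| + |x| + |y| + |z| := by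
    intro u v w x y z
    have := abs_neg u
    have := abs_add_le (-u + v + w + x + y) z
    have := abs_add_le (-u + v + w + x) y
    have := abs_add_le (-u + v + w) x
    have := abs_add_le (-u + v) w
    have := abs_add_le (-u) v
    linarith
  refine (tri _ _ _ _ _ _).trans ?_
  have hMY : 0 < M*Y := by positivity
  have hCY : 0 < C*Y := by positivity
  have A0 : 0 ≤ |a|/r := by positivity
  have B0 : 0 ≤ |b|/r := by positivity
  have P0 : 0 ≤ |p|/ρ^3 := by positivity
  have T0 : 0 ≤ ε*(|at'|/r) := by positivity
  have R0 : 0 ≤ ε*(d*|ar|/r) := by positivity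
  have ea : ∀ z : ℝ, 1/r*|z| = |z|/r := fun z => by ring
  calc _ ≤ M*Y*(1/r)*(2*|b| + 40*|a|) + 3*(|p|/ρ^3) + 2*C*Y*(1/r)*(|a| + |b|)
        + C*(1/r)*(|a| + |b|) + C*Y*(ε*(|at'|/r))
        + (C*Y*(ε*(d*|ar|/r)) + C*Y*(1/r)*(2*|b| + 23*|a|)) := by gcongr
    _ = (40*(M*Y) + C + 25*(C*Y))*(|a|/r) + (2*(M*Y) + C + 4*(C*Y))*(|b|/r) + 3*(|p|/ρ^3)
        + C*Y*(ε*(|at'|/r)) + C*Y*(ε*(d*|ar|/r)) := by ring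
    _ ≤ (40*M*Y + 3 + C + 40*C*Y)*(|a|/r) + (40*M*Y + 3 + C + 40*C*Y)*(|b|/r)
        + (40*M*Y + 3 + C + 40*C*Y)*(|p|/ρ^3) + (40*M*Y + 3 + C + 40*C*Y)*(ε*(|at'|/r))
        + (40*M*Y + 3 + C + 40*C*Y)*(ε*(d*|ar|/r)) := by
      refine add_le_add (add_le_add (add_le_add (add_le_add ?_ ?_) ?_) ?_) ?_ <;>
        exact mul_le_mul_of_nonneg_right (by linarith) (by assumption)
    _ = _ := by ring

end Pointwise

section EnergyInequality

variable {M C ε : ℝ} {s ℓ : ℕ} {ψ F βt βr : ℝ → ℝ → ℝ}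

lemma BetaBounds.apply (hM : 0 < M) (hβ : BetaBounds M C βt βr) (t : ℝ) {r ρ : ℝ} (hr : 2*M < r)
    (hρ : 0 < ρ) (hrρ : r = ρ^2) :
    |βt t r| ≤ C/r^2 ∧ |βr t r| ≤ C/r^2 ∧ |Wc M βt t r| ≤ C/ρ^3 ∧ |Wc M βr t r| ≤ C/ρ^3 := by
  have h0 : 0 < r := by linarith
  have h := hβ t r hr
  have e : r ^ ((3:ℝ)/2) = ρ^3 := by
    rw [hrρ, ← Real.rpow_natCast ρ 2, ← Real.rpow_mul hρ.le, ← Real.rpow_natCast ρ 3]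
    norm_num
  rw [e] at h
  have h1 : 0 ≤ r^2 * |βt t r| := by positivity
  have h2 : 0 ≤ r^2 * |βr t r| := by positivity
  have h3 : 0 ≤ ρ^3 * |Wc M βt t r| := by positivity
  have h4 : 0 ≤ ρ^3 * |Wc M βr t r| := by positivity
  refine ⟨?_, ?_, ?_, ?_⟩ <;> rw [le_div_iff₀ (by positivity)] <;> linarith

lemma Wc_source (hM : 0 < M) (hβt : SmoothOnRegion βt (Ioi (2*M)))
    (hβr : SmoothOnRegion βr (Ioi (2*M))) (hψ : SmoothOnRegion ψ (Ioi (2*M))) (t : ℝ) {r : ℝ}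
    (hr : 2*M < r) :
    Wc M (fun t r => ε * (βt t r * pt ψ t r + βr t r * pr ψ t r)) t r
      = ε * (Wc M βt t r * pt ψ t r + Wc M βr t r * pr ψ t r + βt t r * pt (Wc M ψ) t r
        + βr t r * (pr (Wc M ψ) t r - kW' M r * (pr ψ t r + gW M r * pt ψ t r)
          - r * dW M r * gW' M r * pt ψ t r)) := by
  have e1 : pt (fun t r => ε * (βt t r * pt ψ t r + βr t r * pr ψ t r)) t r = _ :=
    ((((hβt.hasDerivAt_t hr).mul (hψ.pt.hasDerivAt_t hr)).add
      ((hβr.hasDerivAt_t hr).mul (hψ.pr.hasDerivAt_t hr))).const_mul ε).deriv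
  have e2 : pr (fun t r => ε * (βt t r * pt ψ t r + βr t r * pr ψ t r)) t r = _ :=
    ((((hβt.hasDerivAt_r hr).mul (hψ.pt.hasDerivAt_r hr)).add
      ((hβr.hasDerivAt_r hr).mul (hψ.pr.hasDerivAt_r hr))).const_mul ε).deriv
  rw [Wc_eq _ hM t hr, Wc_eq βt hM t hr, Wc_eq βr hM t hr, pt_Wc hM hψ t hr, pr_Wc hM hψ t hr,
    e1, e2, hψ.pt_pr_comm hr]
  simp only [kW]
  ring

/-- The constant in the pointwise energy inequality. -/
def sourceConst (M C : ℝ) : ℝ := 40*M*(1/√(2*M)) + 3 + C + 40*C*(1/√(2*M))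

lemma five_sq_le (u v w x y : ℝ) :
    (u + v + w + x + y)^2 ≤ 5*(u^2 + v^2 + w^2 + x^2 + y^2) := by
  nlinarith [sq_nonneg (u-v), sq_nonneg (u-w), sq_nonneg (u-x), sq_nonneg (u-y), sq_nonneg (v-w),
    sq_nonneg (v-x), sq_nonneg (v-y), sq_nonneg (w-x), sq_nonneg (w-y), sq_nonneg (x-y)]

lemma damped_source_le {D d S r ρ N T Q a b p u v ε L : ℝ} (hd : 0 < d) (hdD : d^2 = D) (hS : 0 < S)
    (hS2 : S ≤ 2) (hρ : 0 < ρ) (hrρ : r = ρ^2) (hL : 0 ≤ L) (hε : 0 ≤ ε) (hε1 : ε ≤ 1)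
    (hQ : |d * ρ * Q| ≤ N * (|a|/r + |b|/r + |p|/ρ^3 + ε*(|T|/r) + ε*(d*|u|/r))) :
    T * (-(2 * T / (r * D * S)) + Q) + 1/2 * (T^2 / (r * D))
      ≤ 5/2 * N^2 * (a^2/r^2 + b^2/r^2 + L*p^2/r^3 + p^2/r^3
        + ε * (T^2/r^2 + D*u^2/r^2 + L*v^2/r^3 + v^2/r^3)) := by
  have h0 : 0 < r := by rw [hrρ]; positivity
  have hD : 0 < D := by rw [← hdD]; positivity
  have damp : T * -(2 * T / (r * D * S)) ≤ -(T^2 / (r * D)) := by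
    have : T^2 / (r * D) ≤ T^2 / (r * D) * (2 / S) := by
      apply le_mul_of_one_le_right (by positivity)
      rwa [one_le_div hS]
    calc _ = -(T^2 / (r * D) * (2 / S)) := by field_simp
      _ ≤ _ := by linarith
  have cs : T * Q ≤ 1/2 * (T^2 / (r * D)) + 1/2 * (d * ρ * Q)^2 := by
    have e : T * Q = (T / (d * ρ)) * (d * ρ * Q) := by field_simp
    have e2 : T^2 / (r * D) = (T / (d * ρ))^2 := by
      rw [div_pow, mul_pow, hdD, ← hrρ, mul_comm r]
    rw [e, e2]
    nlinarith [sq_nonneg (T / (d * ρ) - d * ρ * Q)]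
  have sqb : (d * ρ * Q)^2 ≤ N^2 * (5 * (a^2/r^2 + b^2/r^2 + L*p^2/r^3 + p^2/r^3
        + ε * (T^2/r^2 + D*u^2/r^2 + L*v^2/r^3 + v^2/r^3))) := by
    have hε2 : ε^2 ≤ ε := by nlinarith
    rw [← sq_abs (d * ρ * Q)]
    refine (pow_le_pow_left₀ (abs_nonneg _) hQ 2).trans ?_
    rw [mul_pow]
    apply mul_le_mul_of_nonneg_left _ (sq_nonneg N)
    refine (five_sq_le _ _ _ _ _).trans ?_
    apply mul_le_mul_of_nonneg_left _ (by norm_num)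
    have hρ6 : (ρ^3)^2 = r^3 := by rw [hrρ]; ring
    simp only [div_pow, mul_pow, sq_abs, hρ6, hdD]
    have e1 : ε^2 * (T^2/r^2) ≤ ε * (T^2/r^2) := by gcongr
    have e2 : ε^2 * (D * u^2/r^2) ≤ ε * (D * u^2/r^2) := by gcongr
    have e3 : 0 ≤ L*p^2/r^3 := by positivity
    have e4 : 0 ≤ ε * (L*v^2/r^3) := by positivity
    have e5 : 0 ≤ ε * (v^2/r^3) := by positivity
    linarith
  linarith

lemma energy_inequality (hM : 0 < M) (hC : 0 < C) (hs : s ≤ 2) (hε : 0 ≤ ε) (hε1 : ε ≤ 1)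
    (hβt : SmoothOnRegion βt (Ioi (2*M))) (hβr : SmoothOnRegion βr (Ioi (2*M)))
    (hβ : BetaBounds M C βt βr) (hψ : SmoothOnRegion ψ (Ioi (2*M)))
    (heq : SolvesPerturbedRW M s ℓ ε βt βr ψ) (t : ℝ) {r : ℝ} (hr : 2*M < r) :
    pt (eT M s ℓ (Wc M ψ)) t r + pr (qT M (Wc M ψ)) t r
        + 1/2 * ((pt (Wc M ψ) t r)^2 / (r * Dc M r))
      ≤ 5/2 * sourceConst M C^2 * (densIBar ℓ ψ t r + ε * densI M ℓ (Wc M ψ) t r) := by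
  have h0 : 0 < r := by linarith
  have hD := Dc_pos hM hr
  have hd := dW_pos hM hr
  have hdD := dW_sq hM hr
  have hd1 : dW M r ≤ 1 := Real.sqrt_le_one.2 (Dc_le_one hM hr)
  obtain ⟨ρ, hρ, hrρ⟩ : ∃ ρ, 0 < ρ ∧ r = ρ^2 := ⟨√r, Real.sqrt_pos.2 h0, (Real.sq_sqrt h0.le).symm⟩
  have hY : 1/ρ ≤ 1/√(2*M) := by
    apply one_div_le_one_div_of_le (by positivity)
    rw [Real.sqrt_le_left hρ.le, ← hrρ]
    exact hr.le
  obtain ⟨b1, b2, b3, b4⟩ := hβ.apply hM t hr hρ hrρ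
  have hk : dW M r * kW' M r = Dc M r + M/r := by
    rw [kW', ← hdD]; field_simp
  have hx : M/r ≤ 1/2 := by rw [div_le_div_iff₀ h0 two_pos]; linarith
  have hx0 : 0 < M/r := by positivity
  have hsg : |1 - (s : ℝ)^2| ≤ 3 := by
    interval_cases s <;> norm_num
  have hb := source_bound (E := ε * (βt t r * pt ψ t r + βr t r * pr ψ t r)) (p := ψ t r)
    (a := pt ψ t r) (b := pr ψ t r) (at' := pt (Wc M ψ) t r) (ar := pr (Wc M ψ) t r)
    hM hC hρ hrρ hr hY hd hd1 (by rw [hk]; positivity)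
    (by rw [hk]; linarith [Dc_le_one hM hr]) (abs_gW_le hM hr) (abs_gW'_le hM hr)
    (abs_hW_le hM hr) hsg hε hε1 b1 b2 b3 b4 rfl
  rw [← Wc_source hM hβt hβr hψ t hr] at hb
  rw [energy_divergence hM (Wc_smooth hM hψ) t hr, Pc_Wc hM hψ heq t hr]
  refine le_trans (le_of_eq ?_) (damped_source_le (L := (ℓ : ℝ)*((ℓ : ℝ)+1)) (v := Wc M ψ t r) hd hdD
    (sW_pos hM h0) (sW_le_two hM hr) hρ hrρ (by positivity) hε hε1 hb)
  ring

/-- The weight of the Hardy flux; only needed for `s = 0`. -/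
def hardyWeight (s : ℕ) : ℝ := if s = 0 then 2 else 0

/-- The flux in the Hardy inequality. -/
def hardyFlux (M : ℝ) (s : ℕ) (F : ℝ → ℝ → ℝ) : ℝ → ℝ → ℝ := fun t r =>
  -(hardyWeight s * (Dc M r * (1/r) * F t r^2))

lemma densE_le (hM : 0 < M) (hs : s ≤ 2) (hℓ : s ≤ ℓ) (hF : SmoothOnRegion F (Ioi (2*M)))
    (t : ℝ) {r : ℝ} (hr : 2*M < r) :
    densE M ℓ F t r ≤ 10 * eT M s ℓ F t r + pr (hardyFlux M s F) t r := by
  have h0 : 0 < r := by linarith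
  have hD := Dc_pos hM hr
  have hD1 := Dc_le_one hM hr
  have hx : 2*M/r ≤ 1 := by rw [div_le_one h0]; linarith
  have hx0 : 0 < 2*M/r := by positivity
  have e : pr (hardyFlux M s F) t r = _ :=
    ((((hasDerivAt_Dc h0.ne').mul (hasDerivAt_const_div 1 h0.ne')).mul
      ((hF.hasDerivAt_r hr).pow 2)).const_mul (hardyWeight s)).neg.deriv
  rw [e]
  simp only [Pi.mul_apply, Pi.pow_apply, densE, eT]
  set A := pt F t r
  set B := pr F t r
  set u := F t r
  set L := (ℓ : ℝ)*((ℓ : ℝ)+1) with hL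
  have hL0 : 0 ≤ L := by positivity
  obtain ⟨v, hv⟩ : ∃ v, v = u/r := ⟨_, rfl⟩
  have hu : u = v*r := by rw [hv]; field_simp
  have n1 : 0 ≤ 2*M/r*A^2 := by positivity
  have n2 : 0 ≤ Dc M r*B^2 := by positivity
  have n3 : 0 ≤ L*v^2 := by positivity
  have n4 : 0 ≤ 2*M/r*v^2 := by positivity
  have g1 : L*u^2/r^2 = L*v^2 := by rw [hu]; field_simp
  have g2 : u^2/r^2 = v^2 := by rw [hu]; field_simp
  have g3 : ∀ σ : ℝ, (L/r^2 + σ*(2*M/r^3))*u^2 = L*v^2 + σ*(2*M/r*v^2) := by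
    intro σ; rw [hu]; field_simp
  rw [g1, g2, g3]
  interval_cases s
  · have g4 : -(hardyWeight 0 * ((2*M/r^2*(1/r) + Dc M r*-(1/r^2))*u^2
        + Dc M r*(1/r)*(((2:ℕ):ℝ)*u^(2-1)*B)))
        = 2*v^2 - 4*(2*M/r*v^2) - 4*(Dc M r*v*B) := by
      simp only [hardyWeight, if_true, Dc, hu]
      field_simp
      ring
    rw [g4]
    have hD2 : Dc M r*(Dc M r*B^2) ≤ 1*(Dc M r*B^2) := by gcongr
    norm_num
    nlinarith [sq_nonneg (v - 2*(Dc M r*B))]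
  · have : (1:ℝ) ≤ ℓ := by exact_mod_cast hℓ
    have hL2 : 2 ≤ L := by rw [hL]; nlinarith
    simp only [hardyWeight]
    norm_num
    nlinarith [sq_nonneg v, sq_nonneg A]
  · have : (2:ℝ) ≤ ℓ := by exact_mod_cast hℓ
    have hL2 : 6 ≤ L := by rw [hL]; nlinarith
    have n5 : 2*M/r*v^2 ≤ 1*v^2 := by gcongr
    simp only [hardyWeight]
    norm_num
    nlinarith [sq_nonneg v, sq_nonneg A]

lemma eT_le (hM : 0 < M) (t : ℝ) {r : ℝ} (hr : 2*M < r) :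
    eT M s ℓ F t r ≤ 2 * densE M ℓ F t r := by
  have h0 : 0 < r := by linarith
  have hD := Dc_pos hM hr
  have hx : 2*M/r ≤ 1 := by rw [div_le_one h0]; linarith
  simp only [densE, eT]
  set A := pt F t r
  set B := pr F t r
  set u := F t r
  have n2 : 0 ≤ Dc M r*B^2 := by positivity
  have n3 : 0 ≤ (ℓ : ℝ)*((ℓ : ℝ)+1)*u^2/r^2 := by positivity
  have n1 : 2*M/r*A^2 ≤ 1*A^2 := by gcongr
  have n4 : (1 - (s : ℝ)^2) * (2*M/r*(u^2/r^2)) ≤ 1 * (1*(u^2/r^2)) := by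
    gcongr
    nlinarith
  have e : ((ℓ : ℝ)*((ℓ : ℝ)+1)/r^2 + (1 - (s : ℝ)^2) * (2*M/r^3)) * u^2
      = (ℓ : ℝ)*((ℓ : ℝ)+1)*u^2/r^2 + (1 - (s : ℝ)^2) * (2*M/r*(u^2/r^2)) := by
    field_simp
  rw [e]
  linarith [sq_nonneg A, (by positivity : 0 ≤ u^2/r^2)]

end EnergyInequality

/-! ### Integration over rectangles -/

section Integration

variable {c a R τ : ℝ} {G e q : ℝ → ℝ → ℝ}

lemma integrableOn_rectangle (hG : ContinuousOn (Function.uncurry G) (univ ×ˢ Ioi c)) (ha : c < a) :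
    IntegrableOn (Function.uncurry G) (Icc (0, a) (τ, R)) :=
  (hG.mono (by
    rw [← Icc_prod_Icc]
    exact prod_mono (subset_univ _) fun r hr => ha.trans_le hr.1)).integrableOn_compact isCompact_Icc

lemma continuousOn_slice (hG : ContinuousOn (Function.uncurry G) (univ ×ˢ Ioi c)) (t : ℝ) :
    ContinuousOn (G t) (Ioi c) :=
  hG.comp (f := fun r => (t, r)) (by fun_prop) fun _ hr => ⟨mem_univ _, hr⟩

lemma intervalIntegrable_slice (hG : ContinuousOn (Function.uncurry G) (univ ×ˢ Ioi c))
    (ha : c < a) (haR : a ≤ R) (t : ℝ) : IntervalIntegrable (G t) volume a R :=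
  ((continuousOn_slice hG t).mono fun r hr => by
    rw [uIcc_of_le haR] at hr
    exact ha.trans_le hr.1).intervalIntegrable

lemma integral_divergence_rectangle (he : SmoothOnRegion e (Ioi c)) (hq : SmoothOnRegion q (Ioi c))
    (ha : c < a) (haR : a ≤ R) (hτ : 0 ≤ τ) :
    ∫ x in Icc (0, a) (τ, R), (pt e x.1 x.2 + pr q x.1 x.2)
      = (((∫ t in 0..τ, q t R) - ∫ t in 0..τ, q t a) + ∫ r in a..R, e τ r) - ∫ r in a..R, e 0 r := by
  have hsub : Icc ((0 : ℝ), a) (τ, R) ⊆ univ ×ˢ Ioi c := by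
    rw [← Icc_prod_Icc]
    exact prod_mono (subset_univ _) fun r hr => ha.trans_le hr.1
  have hcongr : ∀ x ∈ Icc ((0 : ℝ), a) (τ, R), fderiv ℝ (Function.uncurry e) x (1, 0)
      + fderiv ℝ (Function.uncurry q) x (0, 1) = pt e x.1 x.2 + pr q x.1 x.2 := fun x hx => by
    rw [he.pt_eq (hsub hx).2, hq.pr_eq (hsub hx).2]
  have hint : IntegrableOn (fun x : ℝ × ℝ => pt e x.1 x.2 + pr q x.1 x.2) (Icc (0, a) (τ, R)) :=
    integrableOn_rectangle (G := fun t r => pt e t r + pr q t r)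
      (ContDiffOn.continuousOn (he.pt.add hq.pr)) ha
  have h := integral_divergence_prod_Icc_of_hasFDerivAt_of_le (Function.uncurry e)
    (Function.uncurry q) (fderiv ℝ (Function.uncurry e)) (fderiv ℝ (Function.uncurry q))
    (0, a) (τ, R) ⟨hτ, haR⟩ ((ContDiffOn.continuousOn he).mono hsub)
    ((ContDiffOn.continuousOn hq).mono hsub) (fun x hx => he.hasFDerivAt (ha.trans hx.2.1))
    (fun x hx => hq.hasFDerivAt (ha.trans hx.2.1))
    (hint.congr_fun (fun x hx => (hcongr x hx).symm) measurableSet_Icc)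
  rw [← setIntegral_congr_fun measurableSet_Icc hcongr]
  exact h

lemma setLIntegral_region_prod (hG : ContinuousOn (Function.uncurry G) (univ ×ˢ Ioi c)) {A B : Set ℝ}
    (hA : MeasurableSet A) (hB : MeasurableSet B) (hBc : B ⊆ Ioi c) :
    ∫⁻ x in A ×ˢ B, ENNReal.ofReal (Function.uncurry G x)
      = ∫⁻ t in A, ∫⁻ r in B, ENNReal.ofReal (G t r) :=
  setLIntegral_prod _
    (((hG.mono (prod_mono (subset_univ _) hBc)).aemeasurable (hA.prod hB)).ennreal_ofReal)

lemma ofReal_integral_rectangle (hG : ContinuousOn (Function.uncurry G) (univ ×ˢ Ioi c))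
    (hG0 : ∀ t r, c < r → 0 ≤ G t r) (ha : c < a) :
    ENNReal.ofReal (∫ x in Icc (0, a) (τ, R), Function.uncurry G x)
      = ∫⁻ t in Ioc 0 τ, ∫⁻ r in Icc a R, ENNReal.ofReal (G t r) := by
  rw [ofReal_integral_eq_lintegral_ofReal (integrableOn_rectangle hG ha)
    (ae_restrict_of_forall_mem measurableSet_Icc fun x hx => hG0 _ _ (ha.trans_le hx.1.2)),
    ← Icc_prod_Icc, setLIntegral_region_prod hG measurableSet_Icc measurableSet_Icc
      fun r hr => ha.trans_le hr.1]
  exact setLIntegral_congr Ioc_ae_eq_Icc.symm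

lemma ofReal_integral_slice (hG : ContinuousOn (Function.uncurry G) (univ ×ˢ Ioi c))
    (hG0 : ∀ t r, c < r → 0 ≤ G t r) (ha : c < a) (haR : a ≤ R) (t : ℝ) :
    ENNReal.ofReal (∫ r in a..R, G t r) = ∫⁻ r in Icc a R, ENNReal.ofReal (G t r) := by
  rw [intervalIntegral.integral_of_le haR, ofReal_integral_eq_lintegral_ofReal
    ((intervalIntegrable_iff_integrableOn_Ioc_of_le haR).1 (intervalIntegrable_slice hG ha haR t))
    (ae_restrict_of_forall_mem measurableSet_Ioc fun r hr => hG0 _ _ (ha.trans hr.1))]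
  exact setLIntegral_congr Ioc_ae_eq_Icc

lemma tendsto_setLIntegral_iUnion {α : Type*} [MeasurableSpace α] {μ : Measure α} (f : α → ℝ≥0∞)
    {S : ℕ → Set α} (hS : Monotone S) :
    Filter.Tendsto (fun n => ∫⁻ x in S n, f x ∂μ) Filter.atTop (nhds (∫⁻ x in ⋃ n, S n, f x ∂μ)) := by
  rw [setLIntegral_iUnion_of_directed f hS.directed_le]
  exact tendsto_atTop_iSup fun m n h => lintegral_mono_set (hS h)

lemma iUnion_Icc_exhaustion (c b : ℝ) : ⋃ n : ℕ, Icc (c + 1/((n:ℝ)+1)) (b + n) = Ioi c := by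
  ext r
  simp only [mem_iUnion, mem_Icc, mem_Ioi]
  constructor
  · rintro ⟨n, hn, -⟩
    have : 0 < 1/((n:ℝ)+1) := by positivity
    linarith
  · intro hr
    obtain ⟨m, hm⟩ := exists_nat_one_div_lt (sub_pos.2 hr)
    obtain ⟨k, hk⟩ := exists_nat_ge (r - b)
    refine ⟨max m k, ?_, ?_⟩
    · have : 1/(((max m k : ℕ):ℝ)+1) ≤ 1/((m:ℝ)+1) := by
        apply one_div_le_one_div_of_le (by positivity)
        have : (m:ℝ) ≤ ((max m k : ℕ):ℝ) := by exact_mod_cast le_max_left m k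
        linarith
      linarith
    · have : (k:ℝ) ≤ ((max m k : ℕ):ℝ) := by exact_mod_cast le_max_right m k
      linarith

lemma monotone_Icc_exhaustion (c b : ℝ) :
    Monotone fun n : ℕ => Icc (c + 1/((n:ℝ)+1)) (b + n) := by
  intro m n h
  have h' : (m:ℝ) ≤ n := by exact_mod_cast h
  apply Icc_subset_Icc <;> gcongr

end Integration

/-! ### The energy estimate -/

section EnergyEstimate

variable {M C ε : ℝ} {s ℓ : ℕ} {ψ F βt βr : ℝ → ℝ → ℝ}

lemma horizon_flux_le (hM : 0 < M) (hψ : SmoothOnRegion ψ (Ici (2*M))) (s : ℕ) (τ : ℝ) :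
    ∃ K, 0 ≤ K ∧ ∀ t r, t ∈ Icc 0 τ → 2*M < r → r ≤ 2*M + 1 →
      qT M (Wc M ψ) t r ≤ K * Dc M r ∧ -hardyFlux M s (Wc M ψ) t r ≤ K * Dc M r := by
  let φ : ℝ → ℝ → ℝ := fun t r => pr ψ t r + gW M r * pt ψ t r
  have hg : SmoothOnRegion (fun _ r => gW M r) (Ici (2*M)) :=
    smoothOnRegion_radial ((contDiffOn_gW hM).mono (Ici_subset_Ioi.2 (by positivity)))
  have hφ : SmoothUpTo (2*M) φ := hψ.smoothUpTo.pr.add (hg.smoothUpTo.mul hψ.smoothUpTo.pt)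
  have hW : ∀ t r, 2*M < r → Wc M ψ t r = kW M r * φ t r := fun t r hr => Wc_eq ψ hM t hr
  obtain ⟨K₀, h₀⟩ := hφ.bounded 0 τ (2*M + 1)
  obtain ⟨K₁, h₁⟩ := hφ.pt.bounded 0 τ (2*M + 1)
  obtain ⟨K₂, h₂⟩ := hφ.pr.bounded 0 τ (2*M + 1)
  refine ⟨(3*M + 1)*(|K₀| * |K₁|) + (2*M + 1)^2*(|K₂| * |K₁|) + 2*((2*M + 1)*|K₀|^2), by positivity,
    fun t r ht hr hr1 => ?_⟩
  have h0 : 0 < r := by linarith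
  have hD := Dc_pos hM hr
  have hD1 := Dc_le_one hM hr
  have hd := dW_pos hM hr
  have hkk : kW M r * kW' M r = r * Dc M r + M := by
    rw [kW, kW', ← dW_sq hM hr]; field_simp
  have hk2 : kW M r^2 = r^2 * Dc M r := by
    rw [kW, mul_pow, dW_sq hM hr]
  have b₀ : |φ t r| ≤ |K₀| := (h₀ t r ht hr hr1).trans (le_abs_self _)
  have b₁ : |pt φ t r| ≤ |K₁| := (h₁ t r ht hr hr1).trans (le_abs_self _)
  have b₂ : |pr φ t r| ≤ |K₂| := (h₂ t r ht hr hr1).trans (le_abs_self _)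
  have ept : pt (Wc M ψ) t r = kW M r * pt φ t r := by
    rw [pt_congr hW hr]
    exact ((hφ.smooth.hasDerivAt_t hr).const_mul _).deriv
  have epr : pr (Wc M ψ) t r = kW' M r * φ t r + kW M r * pr φ t r := by
    rw [pr_congr hW hr]
    exact ((hasDerivAt_kW hM hr).mul (hφ.smooth.hasDerivAt_r hr)).deriv
  have hrD : r * Dc M r ≤ r := mul_le_of_le_one_right h0.le hD1
  have hrD0 : 0 < r * Dc M r := by positivity
  constructor
  · have key : pr (Wc M ψ) t r * pt (Wc M ψ) t r
        = (r * Dc M r + M) * (φ t r * pt φ t r) + r^2 * Dc M r * (pr φ t r * pt φ t r) := by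
      rw [ept, epr, ← hkk, ← hk2]; ring
    have h1 : |(r * Dc M r + M) * (φ t r * pt φ t r)| ≤ (3*M + 1)*(|K₀| * |K₁|) := by
      have : r * Dc M r + M ≤ 3*M + 1 := by linarith
      rw [abs_mul, abs_mul, abs_of_pos (by linarith)]
      gcongr
    have h2 : |r^2 * Dc M r * (pr φ t r * pt φ t r)| ≤ (2*M + 1)^2*(|K₂| * |K₁|) := by
      rw [abs_mul, abs_mul (pr φ t r), abs_of_pos (by positivity)]
      gcongr
      calc r^2 * Dc M r ≤ r^2 := mul_le_of_le_one_right (by positivity) hD1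
        _ ≤ _ := by gcongr
    have h3 : 0 ≤ 2*((2*M + 1)*|K₀|^2) := by positivity
    have h4 : 0 ≤ 2*M/r * pt (Wc M ψ) t r^2 := by positivity
    rw [qT, mul_assoc, key, mul_comm _ (Dc M r)]
    have := mul_le_mul_of_nonneg_left (show
      -((r * Dc M r + M) * (φ t r * pt φ t r) + r^2 * Dc M r * (pr φ t r * pt φ t r))
        ≤ (3*M + 1)*(|K₀| * |K₁|) + (2*M + 1)^2*(|K₂| * |K₁|) + 2*((2*M + 1)*|K₀|^2) by
        linarith [neg_abs_le ((r * Dc M r + M) * (φ t r * pt φ t r)),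
          neg_abs_le (r^2 * Dc M r * (pr φ t r * pt φ t r))]) hD.le
    linarith
  · have hw : hardyWeight s ≤ 2 := by unfold hardyWeight; split_ifs <;> norm_num
    have hw0 : 0 ≤ hardyWeight s := by unfold hardyWeight; split_ifs <;> norm_num
    have e : -hardyFlux M s (Wc M ψ) t r
        = hardyWeight s * ((r * Dc M r) * |φ t r|^2) * Dc M r := by
      simp only [hardyFlux, hW t r hr, mul_pow, hk2, sq_abs]
      field_simp
    rw [e]
    apply mul_le_mul_of_nonneg_right _ hD.le
    have : hardyWeight s * ((r * Dc M r) * |φ t r|^2) ≤ 2*((2*M + 1)*|K₀|^2) := by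
      gcongr
      linarith
    have h5 : 0 ≤ (3*M + 1)*(|K₀| * |K₁|) + (2*M + 1)^2*(|K₂| * |K₁|) := by positivity
    linarith

lemma contDiffOn_inv_snd (hM : 0 < M) :
    ContDiffOn ℝ (⊤ : ℕ∞) (fun x : ℝ × ℝ => (x.2)⁻¹) (univ ×ˢ Ioi (2*M)) :=
  contDiffOn_snd.inv fun x hx => by
    have : 2*M < x.2 := hx.2
    linarith

lemma SmoothOnRegion.eT (hM : 0 < M) (hF : SmoothOnRegion F (Ioi (2*M))) :
    SmoothOnRegion (eT M s ℓ F) (Ioi (2*M)) := by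
  have h0 : ContDiffOn ℝ (⊤ : ℕ∞) (fun x : ℝ × ℝ => F x.1 x.2) (univ ×ˢ Ioi (2*M)) := hF
  have h1 : ContDiffOn ℝ (⊤ : ℕ∞) (fun x : ℝ × ℝ => _root_.pt F x.1 x.2) (univ ×ˢ Ioi (2*M)) := hF.pt
  have h2 : ContDiffOn ℝ (⊤ : ℕ∞) (fun x : ℝ × ℝ => _root_.pr F x.1 x.2) (univ ×ˢ Ioi (2*M)) := hF.pr
  have h3 := contDiffOn_inv_snd hM
  change ContDiffOn ℝ (⊤ : ℕ∞) (fun x : ℝ × ℝ => _root_.eT M s ℓ F x.1 x.2) _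
  simp only [_root_.eT, Dc, div_eq_mul_inv, ← inv_pow]
  fun_prop

lemma SmoothOnRegion.qT (hM : 0 < M) (hF : SmoothOnRegion F (Ioi (2*M))) :
    SmoothOnRegion (qT M F) (Ioi (2*M)) := by
  have h1 : ContDiffOn ℝ (⊤ : ℕ∞) (fun x : ℝ × ℝ => _root_.pt F x.1 x.2) (univ ×ˢ Ioi (2*M)) := hF.pt
  have h2 : ContDiffOn ℝ (⊤ : ℕ∞) (fun x : ℝ × ℝ => _root_.pr F x.1 x.2) (univ ×ˢ Ioi (2*M)) := hF.pr
  have h3 := contDiffOn_inv_snd hM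
  change ContDiffOn ℝ (⊤ : ℕ∞) (fun x : ℝ × ℝ => _root_.qT M F x.1 x.2) _
  simp only [_root_.qT, Dc, div_eq_mul_inv]
  fun_prop

lemma SmoothOnRegion.hardyFlux (hM : 0 < M) (hF : SmoothOnRegion F (Ioi (2*M))) :
    SmoothOnRegion (hardyFlux M s F) (Ioi (2*M)) := by
  have h0 : ContDiffOn ℝ (⊤ : ℕ∞) (fun x : ℝ × ℝ => F x.1 x.2) (univ ×ˢ Ioi (2*M)) := hF
  have h3 := contDiffOn_inv_snd hM
  change ContDiffOn ℝ (⊤ : ℕ∞) (fun x : ℝ × ℝ => _root_.hardyFlux M s F x.1 x.2) _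
  simp only [_root_.hardyFlux, Dc, div_eq_mul_inv]
  fun_prop

lemma SmoothOnRegion.continuousOn_densities (hM : 0 < M) (hF : SmoothOnRegion F (Ioi (2*M))) :
    ContinuousOn (Function.uncurry (densE M ℓ F)) (univ ×ˢ Ioi (2*M)) ∧
    ContinuousOn (Function.uncurry (densI M ℓ F)) (univ ×ˢ Ioi (2*M)) ∧
    ContinuousOn (Function.uncurry (densIBar ℓ F)) (univ ×ˢ Ioi (2*M)) := by
  have h0 : ContinuousOn (fun x : ℝ × ℝ => F x.1 x.2) (univ ×ˢ Ioi (2*M)) :=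
    ContDiffOn.continuousOn hF
  have h1 : ContinuousOn (fun x : ℝ × ℝ => _root_.pt F x.1 x.2) (univ ×ˢ Ioi (2*M)) :=
    ContDiffOn.continuousOn hF.pt
  have h2 : ContinuousOn (fun x : ℝ × ℝ => _root_.pr F x.1 x.2) (univ ×ˢ Ioi (2*M)) :=
    ContDiffOn.continuousOn hF.pr
  have h3 := (contDiffOn_inv_snd hM).continuousOn
  refine ⟨?_, ?_, ?_⟩ <;>
    simp only [Function.uncurry_def, densE, densI, densIBar, Dc, div_eq_mul_inv, ← inv_pow] <;>
    fun_prop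

/-- The integrand of the damping term. -/
def densDamp (M : ℝ) (F : ℝ → ℝ → ℝ) : ℝ → ℝ → ℝ := fun t r => (pt F t r)^2 / (r * Dc M r)

lemma SmoothOnRegion.continuousOn_densDamp (hM : 0 < M) (hF : SmoothOnRegion F (Ioi (2*M))) :
    ContinuousOn (Function.uncurry (densDamp M F)) (univ ×ˢ Ioi (2*M)) := by
  have h1 : ContinuousOn (fun x : ℝ × ℝ => _root_.pt F x.1 x.2) (univ ×ˢ Ioi (2*M)) :=
    ContDiffOn.continuousOn hF.pt
  refine (h1.pow 2).div (g := fun x : ℝ × ℝ => x.2 * Dc M x.2) ?_ fun x hx => ?_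
  · have h3 := (contDiffOn_inv_snd hM).continuousOn
    simp only [Dc, div_eq_mul_inv]
    fun_prop
  · have := Dc_pos hM hx.2
    have : 2*M < x.2 := hx.2
    have : 0 < x.2 := by linarith
    positivity

lemma densities_nonneg (hM : 0 < M) (F : ℝ → ℝ → ℝ) (t : ℝ) {r : ℝ} (hr : 2*M < r) :
    0 ≤ densE M ℓ F t r ∧ 0 ≤ densI M ℓ F t r ∧ 0 ≤ densIBar ℓ F t r ∧ 0 ≤ densDamp M F t r := by
  have h0 : 0 < r := by linarith
  have hD := Dc_pos hM hr
  unfold densE densI densIBar densDamp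
  refine ⟨?_, ?_, ?_, ?_⟩ <;> positivity

lemma Wc_vanishes (hM : 0 < M) (hψ : CompactRSupport ψ) (a b : ℝ) :
    ∃ R, 2*M ≤ R ∧ VanishesOn a b R (Wc M ψ) := by
  obtain ⟨R, hR⟩ := hψ a b
  have h : VanishesOn a b R ψ := fun t r ha hb hr => hR t r ⟨ha.le, hb.le⟩ hr.le
  refine ⟨max R (2*M), le_max_right _ _, fun t r ha hb hr => ?_⟩
  have hr' := (le_max_left _ _).trans_lt hr
  rw [Wc_eq ψ hM t ((le_max_right _ _).trans_lt hr), h.pt t r ha hb hr', h.pr t r ha hb hr']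
  ring

lemma truncated_energy_estimate (hM : 0 < M) (hC : 0 < C) (hs : s ≤ 2) (hℓ : s ≤ ℓ) (hε : 0 ≤ ε)
    (hε1 : ε ≤ 1) (hβt : SmoothOnRegion βt (Ioi (2*M))) (hβr : SmoothOnRegion βr (Ioi (2*M)))
    (hβ : BetaBounds M C βt βr) (hψ : SmoothOnRegion ψ (Ici (2*M))) (hsupp : CompactRSupport ψ)
    (heq : SolvesPerturbedRW M s ℓ ε βt βr ψ) {τ : ℝ} (hτ : 0 < τ) :
    ∃ K R₀, 0 ≤ K ∧ 2*M + 1 ≤ R₀ ∧ ∀ a R, 2*M < a → a ≤ 2*M + 1 → R₀ ≤ R →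
      (∫ r in a..R, densE M ℓ (Wc M ψ) τ r)
          + ∫ x in Icc (0, a) (τ, R), Function.uncurry (densDamp M (Wc M ψ)) x
        ≤ (20 + 25 * sourceConst M C^2) * ((∫ r in a..R, densE M ℓ (Wc M ψ) 0 r)
            + (∫ x in Icc (0, a) (τ, R), Function.uncurry (densIBar ℓ ψ) x)
            + ε * ∫ x in Icc (0, a) (τ, R), Function.uncurry (densI M ℓ (Wc M ψ)) x)
          + K * Dc M a := by
  have hψ' := hψ.smoothUpTo.smooth
  have hΨ := Wc_smooth hM hψ'
  obtain ⟨K, hK, hflux⟩ := horizon_flux_le hM hψ s τ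
  obtain ⟨R₀, hR₀, hvan⟩ := Wc_vanishes hM hsupp (-1) (τ + 1)
  refine ⟨10 * (K * τ) + K, R₀ + 1, by positivity, by linarith, fun a R ha ha1 hR => ?_⟩
  have haR : a ≤ R := by linarith
  have hcE := (hΨ.continuousOn_densities (ℓ := ℓ) hM).1
  have hcI := (hΨ.continuousOn_densities (ℓ := ℓ) hM).2.1
  have hcB := (hψ'.continuousOn_densities (ℓ := ℓ) hM).2.2
  have hcD := hΨ.continuousOn_densDamp hM
  have he : SmoothOnRegion (eT M s ℓ (Wc M ψ)) (Ioi (2*M)) := hΨ.eT hM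
  have hq : SmoothOnRegion (qT M (Wc M ψ)) (Ioi (2*M)) := hΨ.qT hM
  have hh : SmoothOnRegion (hardyFlux M s (Wc M ψ)) (Ioi (2*M)) := hΨ.hardyFlux hM
  have hdiv := integral_divergence_rectangle he hq ha haR hτ.le
  have hqR : ∫ t in 0..τ, qT M (Wc M ψ) t R = 0 := by
    refine (intervalIntegral.integral_congr (g := fun _ => 0) fun t ht => ?_).trans (by simp)
    rw [uIcc_of_le hτ.le] at ht
    have h1 := hvan.pt t R (by linarith [ht.1]) (by linarith [ht.2]) (by linarith)
    simp [qT, h1]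
  have hqa : ∫ t in 0..τ, qT M (Wc M ψ) t a ≤ K * τ * Dc M a := by
    have hint : IntervalIntegrable (fun t => qT M (Wc M ψ) t a) volume 0 τ :=
      (ContDiffOn.continuousOn hq |>.comp (f := fun t => (t, a)) (s := uIcc 0 τ) (by fun_prop)
        fun _ _ => ⟨mem_univ _, ha⟩).intervalIntegrable
    calc _ ≤ ∫ _ in 0..τ, K * Dc M a := intervalIntegral.integral_mono_on hτ.le hint
          intervalIntegrable_const fun t ht => (hflux t a ht ha ha1).1
      _ = _ := by simp; ring
  have hsrc : (∫ x in Icc (0, a) (τ, R),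
        (pt (eT M s ℓ (Wc M ψ)) x.1 x.2 + pr (qT M (Wc M ψ)) x.1 x.2))
      + 1/2 * ∫ x in Icc (0, a) (τ, R), Function.uncurry (densDamp M (Wc M ψ)) x
      ≤ 5/2 * sourceConst M C^2 * ((∫ x in Icc (0, a) (τ, R), Function.uncurry (densIBar ℓ ψ) x)
        + ε * ∫ x in Icc (0, a) (τ, R), Function.uncurry (densI M ℓ (Wc M ψ)) x) := by
    have i0 : IntegrableOn (fun x : ℝ × ℝ => pt (eT M s ℓ (Wc M ψ)) x.1 x.2
        + pr (qT M (Wc M ψ)) x.1 x.2) (Icc (0, a) (τ, R)) :=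
      integrableOn_rectangle (G := fun t r => pt (eT M s ℓ (Wc M ψ)) t r + pr (qT M (Wc M ψ)) t r)
        (ContDiffOn.continuousOn (he.pt.add hq.pr)) ha
    have i1 : IntegrableOn _ (Icc (0, a) (τ, R)) := integrableOn_rectangle hcD ha
    have i2 : IntegrableOn _ (Icc (0, a) (τ, R)) := integrableOn_rectangle hcB ha
    have i3 : IntegrableOn _ (Icc (0, a) (τ, R)) := integrableOn_rectangle hcI ha
    rw [← integral_const_mul, ← integral_const_mul, ← integral_add i0 (i1.const_mul _),
      ← integral_add i2 (i3.const_mul _), ← integral_const_mul]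
    exact setIntegral_mono_on (i0.add (i1.const_mul _)) ((i2.add (i3.const_mul _)).const_mul _)
      measurableSet_Icc fun x hx =>
        energy_inequality hM hC hs hε hε1 hβt hβr hβ hψ' heq x.1 (ha.trans_le hx.1.2)
  have hieT : ∀ t, IntervalIntegrable (eT M s ℓ (Wc M ψ) t) volume a R :=
    intervalIntegrable_slice (ContDiffOn.continuousOn he) ha haR
  have hiE : ∀ t, IntervalIntegrable (densE M ℓ (Wc M ψ) t) volume a R :=
    intervalIntegrable_slice hcE ha haR
  have hupper : ∫ r in a..R, eT M s ℓ (Wc M ψ) 0 r ≤ 2 * ∫ r in a..R, densE M ℓ (Wc M ψ) 0 r := by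
    rw [← intervalIntegral.integral_const_mul]
    exact intervalIntegral.integral_mono_on haR (hieT 0) ((hiE 0).const_mul _)
      fun r hr => eT_le hM 0 (ha.trans_le hr.1)
  have hlower : ∫ r in a..R, densE M ℓ (Wc M ψ) τ r
      ≤ 10 * (∫ r in a..R, eT M s ℓ (Wc M ψ) τ r) + K * Dc M a := by
    have hih : IntervalIntegrable (pr (hardyFlux M s (Wc M ψ)) τ) volume a R :=
      intervalIntegrable_slice (ContDiffOn.continuousOn hh.pr) ha haR τ
    have hftc : ∫ r in a..R, pr (hardyFlux M s (Wc M ψ)) τ r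
        = hardyFlux M s (Wc M ψ) τ R - hardyFlux M s (Wc M ψ) τ a :=
      intervalIntegral.integral_eq_sub_of_hasDerivAt (fun r hr => hh.hasDerivAt_r (by
        rw [uIcc_of_le haR] at hr
        exact ha.trans_le hr.1)) hih
    have hR0 : hardyFlux M s (Wc M ψ) τ R = 0 := by
      simp [hardyFlux, hvan τ R (by linarith) (by linarith) (by linarith)]
    have hmono := intervalIntegral.integral_mono_on haR (hiE τ)
      (((hieT τ).const_mul 10).add hih) fun r hr => densE_le hM hs hℓ hΨ τ (ha.trans_le hr.1)
    rw [intervalIntegral.integral_add ((hieT τ).const_mul 10) hih,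
      intervalIntegral.integral_const_mul, hftc, hR0] at hmono
    linarith [(hflux τ a ⟨hτ.le, le_rfl⟩ ha ha1).2]
  have nonneg2 : ∀ {G : ℝ → ℝ → ℝ}, (∀ t r, 2*M < r → 0 ≤ G t r) →
      0 ≤ ∫ x in Icc (0, a) (τ, R), Function.uncurry G x := fun hG =>
    setIntegral_nonneg measurableSet_Icc fun x hx => hG _ _ (ha.trans_le hx.1.2)
  have n1 := nonneg2 fun t r hr => (densities_nonneg (ℓ := ℓ) hM (Wc M ψ) t hr).2.1
  have n2 := nonneg2 fun t r hr => (densities_nonneg (ℓ := ℓ) hM ψ t hr).2.2.1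
  have n3 := nonneg2 fun t r hr => (densities_nonneg (ℓ := ℓ) hM (Wc M ψ) t hr).2.2.2
  have n4 : 0 ≤ ∫ r in a..R, densE M ℓ (Wc M ψ) 0 r :=
    intervalIntegral.integral_nonneg haR fun r hr =>
      (densities_nonneg hM (Wc M ψ) 0 (ha.trans_le hr.1)).1
  have n5 := mul_nonneg hε n1
  have n6 := mul_nonneg (sq_nonneg (sourceConst M C)) n4
  linarith

end EnergyEstimate

/-- **Eq. (11): mode-reduced energy estimate for `Wψ`.** -/
theorem energy_estimate_Wpsi (M C : ℝ) (hM : 0 < M) (hC : 0 < C) (s : ℕ) (hs : s ≤ 2) :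
    ∃ Ct : ℝ, 0 < Ct ∧
      ∀ (ℓ : ℕ), s ≤ ℓ →
      ∀ ε : ℝ, 0 ≤ ε → ε ≤ 1 →
      ∀ βt βr ψ : ℝ → ℝ → ℝ,
        SmoothOnRegion βt (Ioi (2*M)) → SmoothOnRegion βr (Ioi (2*M)) →
        BetaBounds M C βt βr →
        SmoothOnRegion ψ (Ici (2*M)) → CompactRSupport ψ →
        SolvesPerturbedRW M s ℓ ε βt βr ψ →
        ∀ τ : ℝ, 0 < τ →
          eE M ℓ (Wc M ψ) τ
              + ∫⁻ τ' in Ioc (0:ℝ) τ, ∫⁻ r in Ioi (2*M),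
                  ENNReal.ofReal ((pt (Wc M ψ) τ' r)^2 / (r * Dc M r))
            ≤ ENNReal.ofReal Ct * (eE M ℓ (Wc M ψ) 0 + iNdegBar M ℓ ψ 0 τ
                + ENNReal.ofReal ε * iNdeg M ℓ (Wc M ψ) 0 τ) := by
  refine ⟨20 + 25 * sourceConst M C^2, by positivity, ?_⟩
  intro ℓ hℓ ε hε hε1 βt βr ψ hβt hβr hβ hψ hsupp heq τ hτ
  obtain ⟨K, R₀, hK, hR₀, htrunc⟩ :=
    truncated_energy_estimate hM hC hs hℓ hε hε1 hβt hβr hβ hψ hsupp heq hτ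
  have hψ' := hψ.smoothUpTo.smooth
  have hΨ := Wc_smooth hM hψ'
  have hcE := (hΨ.continuousOn_densities (ℓ := ℓ) hM).1
  have hcI := (hΨ.continuousOn_densities (ℓ := ℓ) hM).2.1
  have hcB := (hψ'.continuousOn_densities (ℓ := ℓ) hM).2.2
  have hcD := hΨ.continuousOn_densDamp hM
  have nE : ∀ t r, 2*M < r → 0 ≤ densE M ℓ (Wc M ψ) t r :=
    fun t r hr => (densities_nonneg hM _ t hr).1
  have nI : ∀ t r, 2*M < r → 0 ≤ densI M ℓ (Wc M ψ) t r :=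
    fun t r hr => (densities_nonneg hM _ t hr).2.1
  have nB : ∀ t r, 2*M < r → 0 ≤ densIBar ℓ ψ t r :=
    fun t r hr => (densities_nonneg (ℓ := ℓ) hM ψ t hr).2.2.1
  have nD : ∀ t r, 2*M < r → 0 ≤ densDamp M (Wc M ψ) t r :=
    fun t r hr => (densities_nonneg (ℓ := ℓ) hM _ t hr).2.2.2
  set a : ℕ → ℝ := fun n => 2*M + 1/((n:ℝ)+1) with ha_def
  have ha : ∀ n, 2*M < a n := fun n => lt_add_of_pos_right _ (by positivity)
  have ha1 : ∀ n, a n ≤ 2*M + 1 := fun n => by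
    have : 1/((n:ℝ)+1) ≤ 1 := by rw [div_le_one (by positivity)]; linarith [n.cast_nonneg (α := ℝ)]
    simp only [ha_def]; linarith
  have hR : ∀ n : ℕ, R₀ ≤ R₀ + n := fun n => le_add_of_nonneg_right n.cast_nonneg
  have hsub : ∀ n : ℕ, Icc (a n) (R₀ + n) ⊆ Ioi (2*M) := fun n r hr => (ha n).trans_le hr.1
  have bound : ∀ n : ℕ, (∫⁻ r in Icc (a n) (R₀ + n), ENNReal.ofReal (densE M ℓ (Wc M ψ) τ r))
        + ∫⁻ x in Ioc 0 τ ×ˢ Icc (a n) (R₀ + n),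
          ENNReal.ofReal (Function.uncurry (densDamp M (Wc M ψ)) x)
      ≤ ENNReal.ofReal (20 + 25 * sourceConst M C^2) * (eE M ℓ (Wc M ψ) 0 + iNdegBar M ℓ ψ 0 τ
          + ENNReal.ofReal ε * iNdeg M ℓ (Wc M ψ) 0 τ) + ENNReal.ofReal (K * Dc M (a n)) := by
    intro n
    have haR : a n ≤ R₀ + n := (ha1 n).trans (hR₀.trans (hR n))
    have h := ENNReal.ofReal_le_ofReal (htrunc (a n) (R₀ + n) (ha n) (ha1 n) (hR n))
    have p1 : 0 ≤ ∫ r in a n..R₀ + n, densE M ℓ (Wc M ψ) 0 r :=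
      intervalIntegral.integral_nonneg haR fun r hr => nE 0 r (hsub n hr)
    have nonneg2 : ∀ {G : ℝ → ℝ → ℝ}, (∀ t r, 2*M < r → 0 ≤ G t r) →
        0 ≤ ∫ x in Icc (0, a n) (τ, R₀ + n), Function.uncurry G x := fun hG =>
      setIntegral_nonneg measurableSet_Icc fun x hx => hG _ _ ((ha n).trans_le hx.1.2)
    have p2 := nonneg2 nB
    have p3 := mul_nonneg hε (nonneg2 nI)
    have hDn := mul_nonneg hK (Dc_pos hM (ha n)).le
    rw [ENNReal.ofReal_add (intervalIntegral.integral_nonneg haR fun r hr => nE τ r (hsub n hr))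
        (nonneg2 nD), ENNReal.ofReal_add (by positivity) hDn, ENNReal.ofReal_mul (by positivity),
      ENNReal.ofReal_add (add_nonneg p1 p2) p3, ENNReal.ofReal_add p1 p2, ENNReal.ofReal_mul hε,
      ofReal_integral_slice hcE nE (ha n) haR, ofReal_integral_slice hcE nE (ha n) haR,
      ofReal_integral_rectangle hcD nD (ha n), ofReal_integral_rectangle hcB nB (ha n),
      ofReal_integral_rectangle hcI nI (ha n)] at h
    rw [setLIntegral_region_prod hcD measurableSet_Ioc measurableSet_Icc (hsub n)]
    refine h.trans ?_
    gcongr ENNReal.ofReal _ * (?_ + ?_ + _ * ?_) + _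
    · exact lintegral_mono_set (hsub n)
    · exact lintegral_mono fun t => lintegral_mono_set (hsub n)
    · exact lintegral_mono fun t => lintegral_mono_set (hsub n)
  have hmono := monotone_Icc_exhaustion (2*M) R₀
  have lim1 := tendsto_setLIntegral_iUnion (μ := volume)
    (fun r => ENNReal.ofReal (densE M ℓ (Wc M ψ) τ r)) hmono
  have lim2 := tendsto_setLIntegral_iUnion (μ := volume)
    (fun x => ENNReal.ofReal (Function.uncurry (densDamp M (Wc M ψ)) x))
    (fun m n h => prod_mono_right (s := Ioc 0 τ) (hmono h))
  rw [iUnion_Icc_exhaustion] at lim1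
  rw [← prod_iUnion, iUnion_Icc_exhaustion,
    setLIntegral_region_prod hcD measurableSet_Ioc measurableSet_Ioi subset_rfl] at lim2
  have limD : Filter.Tendsto (fun n => ENNReal.ofReal (K * Dc M (a n))) Filter.atTop (nhds 0) := by
    have hlim : Filter.Tendsto a Filter.atTop (nhds (2*M)) := by
      simpa [ha_def] using tendsto_one_div_add_atTop_nhds_zero_nat.const_add (2*M)
    have h := ((hasDerivAt_Dc (M := M) (by positivity : 2*M ≠ 0)).continuousAt.tendsto.comp
      hlim).const_mul K
    have h0 : Dc M (2*M) = 0 := by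
      rw [Dc, div_self (by positivity), sub_self]
    rw [h0, mul_zero] at h
    simpa [Function.comp_def] using (ENNReal.continuous_ofReal.tendsto 0).comp h
  have limR := limD.const_add (ENNReal.ofReal (20 + 25 * sourceConst M C^2) *
    (eE M ℓ (Wc M ψ) 0 + iNdegBar M ℓ ψ 0 τ + ENNReal.ofReal ε * iNdeg M ℓ (Wc M ψ) 0 τ))
  rw [add_zero] at limR
  exact le_of_tendsto_of_tendsto' (lim1.add lim2) limR bound
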